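/- arXiv:1610.02157 — 2 statements merged into one kernel-verified Lean document; each statement's English description precedes it below -/
import Mathlib

section
/- With the setup in the context, assume ω_j(A) < n for every j = 1, …, n−s and 0 < κ ≤ 1. Then there exist β ∈ (0, 1/(2(n+1))) and a constant K_5 > 0, both depending only on s, n, A and U, such that for every t ∈ ℤ_{≥0}, every 1 ≤ k ≤ n−s, and every w ∈ ⋀^k(ℤ^{n+1}) with π_•(w) ≠ 0, one has sup_{x∈U} ‖g̃_t ũ_x w‖ ≥ 2^{−(n+1)/2} K_5. -/
open MeasureTheory Metric Set
open scoped BigOperators ENNReal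

noncomputable section

/-- `x̃ = (1, x)` -/
def tilde {s : ℕ} (x : Fin s → ℝ) : Fin (s + 1) → ℝ := Fin.cons 1 x

/-- The parametrization `x ↦ (x, x̃A)` of the affine subspace. -/
def phiA {s m : ℕ} (A : Matrix (Fin (s + 1)) (Fin m) ℝ) (x : Fin s → ℝ) :
    Fin (s + m) → ℝ :=
  Fin.append x (Matrix.vecMul (tilde x) A)

/-- `(x, x̃A) · q + p`. -/
def dotA {s m : ℕ} (A : Matrix (Fin (s + 1)) (Fin m) ℝ) (x : Fin s → ℝ)
    (q : Fin (s + m) → ℤ) : ℝ :=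
  ∑ j, phiA A x j * (q j : ℝ)

/-- The gradient `[Id_s A'] q` of `x ↦ (x, x̃A)·q`. -/
def gradA {s m : ℕ} (A : Matrix (Fin (s + 1)) (Fin m) ℝ) (q : Fin (s + m) → ℤ) :
    Fin s → ℝ :=
  fun i => (q (Fin.castAdd m i) : ℝ) + ∑ j, A i.succ j * (q (Fin.natAdd s j) : ℝ)

/-- Coordinate `⟨e_i ∧ e_J, w⟩` of the map `c` (zero unless `J ⊆ {1,…,n}` and `i ∉ J`). -/
def cMap {n : ℕ} (w : Finset (Fin (n + 1)) → ℝ) (i : Fin (n + 1))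
    (J : Finset (Fin (n + 1))) : ℝ :=
  if (0 : Fin (n + 1)) ∈ J ∨ i ∈ J then 0
  else (-1 : ℝ) ^ (J.filter (· < i)).card * w (insert i J)

/-- The matrix `R_A = (Id_{s+1} | A)`. -/
def RA {s m : ℕ} (A : Matrix (Fin (s + 1)) (Fin m) ℝ) :
    Matrix (Fin (s + 1)) (Fin (s + m + 1)) ℝ :=
  fun a i =>
    if h : (i : ℕ) < s + 1 then (if (i : ℕ) = (a : ℕ) then 1 else 0)
    else A a ⟨(i : ℕ) - (s + 1), by omega⟩

/-- Coordinates of `R_A c(w)`. -/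
def RAc {s m : ℕ} (A : Matrix (Fin (s + 1)) (Fin m) ℝ)
    (w : Finset (Fin (s + m + 1)) → ℝ) (a : Fin (s + 1)) (J : Finset (Fin (s + m + 1))) : ℝ :=
  ∑ i, RA A a i * cMap w i J

/-- Euclidean norm of `R_A c(w)`. -/
def RAcNorm {s m : ℕ} (A : Matrix (Fin (s + 1)) (Fin m) ℝ)
    (w : Finset (Fin (s + m + 1)) → ℝ) : ℝ :=
  Real.sqrt (∑ a, ∑ J, (RAc A w a J) ^ 2)

/-- Euclidean norm of the projection `π_•(w)` onto `⋀(W_{s+1→n})`. -/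
def pibullNorm (s : ℕ) {n : ℕ} (w : Finset (Fin (n + 1)) → ℝ) : ℝ :=
  Real.sqrt (∑ S : Finset (Fin (n + 1)),
    if ∀ i ∈ S, s < (i : ℕ) then (w S) ^ 2 else 0)

/-- Euclidean norm of an exterior vector in coordinates. -/
def extNorm {N : ℕ} (w : Finset (Fin N) → ℝ) : ℝ :=
  Real.sqrt (∑ S : Finset (Fin N), (w S) ^ 2)

/-- Euclidean norm of the projection `π(w)` onto `⋀(W_{1→n})`. -/
def piNorm {n : ℕ} (w : Finset (Fin (n + 1)) → ℝ) : ℝ :=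
  Real.sqrt (∑ S : Finset (Fin (n + 1)),
    if (0 : Fin (n + 1)) ∉ S then (w S) ^ 2 else 0)

/-- `w` has pure degree `k`. -/
def ExtDeg {N : ℕ} (k : ℕ) (w : Finset (Fin N) → ℝ) : Prop :=
  ∀ S, S.card ≠ k → w S = 0

/-- The set of exponents `v` appearing in the definition of `ω_j(A)`. -/
def expSet (s m : ℕ) (A : Matrix (Fin (s + 1)) (Fin m) ℝ) (j : ℕ) : Set ℝ :=
  {v | 0 < v ∧ ∀ M : ℝ, ∃ w : Finset (Fin (s + m + 1)) → ℤ,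
    (∀ S, S.card ≠ j → w S = 0) ∧
    M < pibullNorm s (fun S => (w S : ℝ)) ∧
    RAcNorm A (fun S => (w S : ℝ)) <
      pibullNorm s (fun S => (w S : ℝ)) ^ (-(v + 1 - j) / j)}

/-- `ω_j(A) < n` for all `j = 1, …, n − s`  (here `n = s + m`). -/
def DiophCond (s m : ℕ) (A : Matrix (Fin (s + 1)) (Fin m) ℝ) : Prop :=
  ∀ j : ℕ, 1 ≤ j → j ≤ m → ∃ v : ℝ, v < (s + m : ℕ) ∧ ∀ u ∈ expSet s m A j, u ≤ v

/-- Action of a matrix on exterior coordinates (compound matrix action). -/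
def extAction {N : ℕ} (M : Matrix (Fin N) (Fin N) ℝ) (w : Finset (Fin N) → ℝ) :
    Finset (Fin N) → ℝ :=
  fun S => ∑ T : Finset (Fin N),
    if h : T.card = S.card then
      (Matrix.of fun a b : Fin S.card =>
          M (S.orderEmbOfFin rfl a) (T.orderEmbOfFin h b)).det * w T
    else 0

/-- The wedge `v_1 ∧ ⋯ ∧ v_k` of vectors, in coordinates. -/
def wedgeOf {N k : ℕ} (v : Fin k → (Fin N → ℝ)) : Finset (Fin N) → ℝ :=
  fun S =>
    if h : S.card = k then
      (Matrix.of fun a b : Fin k => v a (S.orderEmbOfFin h b)).det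
    else 0

/-- Sign for the wedge product of basis monomials. -/
def wedgeSign {N : ℕ} (T T' : Finset (Fin N)) : ℝ :=
  (-1) ^ (∑ a ∈ T, (T'.filter (· < a)).card)

/-- The wedge (exterior) product in coordinates. -/
def wedgeMul {N : ℕ} (u w : Finset (Fin N) → ℝ) : Finset (Fin N) → ℝ :=
  fun S => ∑ T ∈ S.powerset, wedgeSign T (S \ T) * u T * w (S \ T)

/-- The unipotent matrix `u_x` on `ℝ^{1+s+n}`, `n = s+m`, with block rows
`(1, 0, x, x̃A)`, `(0, I_s, I_s, A')`, `(0, 0, I_n)`. -/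
def uMat {s m : ℕ} (A : Matrix (Fin (s + 1)) (Fin m) ℝ) (x : Fin s → ℝ) :
    Matrix (Fin (1 + s + (s + m))) (Fin (1 + s + (s + m))) ℝ :=
  fun i j =>
    if (i : ℕ) = 0 then
      if (j : ℕ) = 0 then 1
      else if h1 : (j : ℕ) < 1 + s then 0
      else if h2 : (j : ℕ) < 1 + s + s then x ⟨(j : ℕ) - (1 + s), by omega⟩
      else ∑ a, tilde x a * A a ⟨(j : ℕ) - (1 + s + s), by have := j.isLt; omega⟩
    else if hi : (i : ℕ) < 1 + s then
      if (j : ℕ) = 0 then 0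
      else if h1 : (j : ℕ) < 1 + s then (if (j : ℕ) = (i : ℕ) then 1 else 0)
      else if h2 : (j : ℕ) < 1 + s + s then (if (j : ℕ) = (i : ℕ) + s then 1 else 0)
      else A ⟨(i : ℕ), by omega⟩ ⟨(j : ℕ) - (1 + s + s), by have := j.isLt; omega⟩
    else if j = i then 1 else 0

/-- The diagonal matrix `g_t = diag(ε/δ, ε/K, …, ε/K, ε/T, …, ε/T)` on `ℝ^{1+s+n}`. -/
def gMat (s m : ℕ) (δ K T ε : ℝ) :
    Matrix (Fin (1 + s + (s + m))) (Fin (1 + s + (s + m))) ℝ :=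
  Matrix.diagonal fun i =>
    if (i : ℕ) = 0 then ε / δ else if (i : ℕ) < 1 + s then ε / K else ε / T

/-- The vector `(p, 0, …, 0, q) ∈ Λ ⊂ ℤ^{1+s+n}`. -/
def lamVec (s m : ℕ) (p : ℤ) (q : Fin (s + m) → ℤ) : Fin (1 + s + (s + m)) → ℝ :=
  fun i =>
    if (i : ℕ) = 0 then (p : ℝ)
    else if h : (i : ℕ) < 1 + s then 0
    else (q ⟨(i : ℕ) - (1 + s), by have := i.isLt; omega⟩ : ℝ)

/-- The matrix `ũ_x` on `ℝ^{n+1}`, with block rows `(1, x, x̃A)` and `(0, I_n)`. -/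
def utMat {s m : ℕ} (A : Matrix (Fin (s + 1)) (Fin m) ℝ) (x : Fin s → ℝ) :
    Matrix (Fin (s + m + 1)) (Fin (s + m + 1)) ℝ :=
  fun i j =>
    if (i : ℕ) = 0 then
      if h : (j : ℕ) = 0 then 1
      else phiA A x ⟨(j : ℕ) - 1, by have := j.isLt; omega⟩
    else if j = i then 1 else 0

/-- The diagonal matrix `g̃_t = diag(ε/δ, ε/T, …, ε/T)` on `ℝ^{n+1}`. -/
def gtMat (s m : ℕ) (δ T ε : ℝ) : Matrix (Fin (s + m + 1)) (Fin (s + m + 1)) ℝ :=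
  Matrix.diagonal fun i => if (i : ℕ) = 0 then ε / δ else ε / T

/-- The function `ν(w) = ‖π_*(w)‖`: the euclidean norm of the part of `w` involving at most
one of the starred basis vectors `e_{*1}, …, e_{*s}` (indices `1, …, s` of `ℝ^{1+s+n}`). -/
def nuFun (s m : ℕ) (w : Finset (Fin (1 + s + (s + m))) → ℝ) : ℝ :=
  Real.sqrt (∑ S : Finset (Fin (1 + s + (s + m))),
    if (S.filter fun i : Fin (1 + s + (s + m)) => 1 ≤ (i : ℕ) ∧ (i : ℕ) < 1 + s).card ≤ 1
    then (w S) ^ 2 else 0)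

/-- `δ := κ/2^{nt}`. -/
def deltaP (s m : ℕ) (κ : ℝ) (t : ℕ) : ℝ := κ / 2 ^ ((s + m) * t)

/-- `K := √(ns/(2r²))·2^{t/2}`. -/
def KofT (s m : ℕ) (r : ℝ) (t : ℕ) : ℝ :=
  Real.sqrt (((s + m : ℕ) : ℝ) * s / (2 * r ^ 2)) * 2 ^ ((t : ℝ) / 2)

/-- `T := 2^{t+1}`. -/
def TofT (t : ℕ) : ℝ := 2 ^ (t + 1)

/-- `ε' := (δKT^{n−1})^{1/(n+1)}`. -/
def epsP' (s m : ℕ) (κ r : ℝ) (t : ℕ) : ℝ :=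
  (deltaP s m κ t * KofT s m r t * TofT t ^ (s + m - 1)) ^ (1 / ((s + m : ℕ) + 1 : ℝ))

/-- `ε := 2^{βt} ε'`. -/
def epsP (s m : ℕ) (κ r β : ℝ) (t : ℕ) : ℝ :=
  (2 : ℝ) ^ (β * t) * epsP' s m κ r t

/-- `‖ỹ c(w)‖` where `ỹ = (1, x, x̃A) = x̃ R_A`. -/
def ycNorm {s m : ℕ} (A : Matrix (Fin (s + 1)) (Fin m) ℝ) (x : Fin s → ℝ)
    (w : Finset (Fin (s + m + 1)) → ℝ) : ℝ :=
  Real.sqrt (∑ J : Finset (Fin (s + m + 1)),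
    (∑ i, (Fin.cons (1 : ℝ) (phiA A x) : Fin (s + m + 1) → ℝ) i * cMap w i J) ^ 2)

/-- A function is `(C, α)`-good on `V ⊆ ℝ^s`. -/
def IsGood (s : ℕ) (C α : ℝ) (f : EuclideanSpace ℝ (Fin s) → ℝ)
    (V : Set (EuclideanSpace ℝ (Fin s))) : Prop :=
  ∀ (y₀ : EuclideanSpace ℝ (Fin s)) (r : ℝ), 0 < r → ball y₀ r ⊆ V →
    ∀ ε : ℝ, 0 < ε →
      volume {x ∈ ball y₀ r | |f x| < ε} ≤
        ENNReal.ofReal (C * (ε / sSup ((fun y => |f y|) '' ball y₀ r)) ^ α) *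
          volume (ball y₀ r)

/-- `V_s`: the volume of the `s`-dimensional euclidean unit ball. -/
def Vball (s : ℕ) : ℝ := (volume (ball (0 : EuclideanSpace ℝ (Fin s)) 1)).toReal

/-- `N_s`: the Besicovitch covering constant of `ℝ^s`. -/
def Nbes (s : ℕ) : ℕ := Besicovitch.multiplicity (EuclideanSpace ℝ (Fin s))

/-- `K_s := 4^{2s+1} s^{s/2} N_s / V_s`. -/
def Kcst (s : ℕ) : ℝ :=
  4 ^ (2 * s + 1) * (s : ℝ) ^ ((s : ℝ) / 2) * (Nbes s : ℝ) / Vball s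

/-- `Γ` is a primitive subgroup of `Λ`: `Γ ≤ Λ` and `Γ_ℝ ∩ Λ = Γ`. -/
def IsPrimitiveIn {d : ℕ} (Λ Γ : Submodule ℤ (Fin d → ℝ)) : Prop :=
  Γ ≤ Λ ∧
    (Submodule.span ℝ (Γ : Set (Fin d → ℝ))).restrictScalars ℤ ⊓ Λ = Γ

/-- `u` is a basis of the discrete subgroup `Γ` (so `u₁ ∧ ⋯ ∧ u_j` represents `Γ`). -/
def Represents {d j : ℕ} (u : Fin j → (Fin d → ℝ)) (Γ : Submodule ℤ (Fin d → ℝ)) : Prop :=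
  LinearIndependent ℝ u ∧ Submodule.span ℤ (Set.range u) = Γ

/-- `w = v₁ ∧ ⋯ ∧ v_k` represents the nonzero primitive rank-`k` subgroup of `ℤ^N`
generated by `v₁, …, v_k`. -/
def RepresentsPrimInt {N k : ℕ} (v : Fin k → (Fin N → ℤ)) (w : Finset (Fin N) → ℝ) : Prop :=
  LinearIndependent ℝ (fun a => fun i => ((v a i : ℝ))) ∧
  (∀ z : Fin N → ℤ,
      ((fun i => (z i : ℝ)) ∈
        Submodule.span ℝ (Set.range fun a => fun i => ((v a i : ℝ)))) →
      z ∈ Submodule.span ℤ (Set.range v)) ∧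
  w = wedgeOf fun a => fun i => ((v a i : ℝ))

/-- The determinant of `(c · [g b = f a])_{a, b}` for increasing sequences `f` and `g`. -/
lemma det_ite_eq_of_strictMono {k N : ℕ} {f g : Fin k → Fin N} (hf : StrictMono f)
    (hg : StrictMono g) (c : ℝ) :
    (Matrix.of fun a b : Fin k => if g b = f a then c else 0).det = if f = g then c ^ k else 0 := by
  split_ifs with h
  · subst h
    have : (Matrix.of fun a b : Fin k => if f b = f a then c else 0) =
        Matrix.diagonal fun _ => c := by
      ext a b
      simp [Matrix.diagonal_apply, hf.injective.eq_iff, eq_comm]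
    rw [this, Matrix.det_diagonal]
    simp
  · obtain ⟨a, ha⟩ : ∃ a, ∀ b, g b ≠ f a := by
      by_contra! hc
      have hsub : Finset.univ.image f ⊆ Finset.univ.image g := by
        intro i hi
        obtain ⟨a, -, rfl⟩ := Finset.mem_image.1 hi
        obtain ⟨b, hb⟩ := hc a
        exact Finset.mem_image.2 ⟨b, Finset.mem_univ _, hb⟩
      have heq := Finset.eq_of_subset_of_card_le hsub (by
        rw [Finset.card_image_of_injective _ hf.injective,
          Finset.card_image_of_injective _ hg.injective])
      apply h
      rw [← hf.range_inj hg]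
      simpa using congrArg (fun s : Finset (Fin N) => (s : Set (Fin N))) heq
    exact Matrix.det_eq_zero_of_row_eq_zero a fun b => by simp [ha b]

lemma orderEmbOfFin_inj {N k : ℕ} {S T : Finset (Fin N)} (hS : S.card = k) (hT : T.card = k) :
    (S.orderEmbOfFin hS : Fin k → Fin N) = T.orderEmbOfFin hT ↔ S = T := by
  refine ⟨fun h => ?_, fun h => by subst h; rfl⟩
  have := congrArg Set.range h
  simpa using this

/-- `extAction` with the cardinality of the index set named. -/
lemma extAction_eq {N k : ℕ} (M : Matrix (Fin N) (Fin N) ℝ) (w : Finset (Fin N) → ℝ)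
    {S : Finset (Fin N)} (hS : S.card = k) :
    extAction M w S = ∑ T : Finset (Fin N),
      if h : T.card = k then
        (Matrix.of fun a b : Fin k => M (S.orderEmbOfFin hS a) (T.orderEmbOfFin h b)).det * w T
      else 0 := by
  subst hS
  rfl

/-- If the rows of `M` other than the zeroth are those of `q • 1`, then `M` scales the coordinates
indexed by sets avoiding `0`. -/
lemma extAction_apply_of_zero_notMem {n : ℕ} {M : Matrix (Fin (n + 1)) (Fin (n + 1)) ℝ} {q : ℝ}
    (hM : ∀ i ≠ 0, ∀ j, M i j = if j = i then q else 0) (w : Finset (Fin (n + 1)) → ℝ)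
    {S : Finset (Fin (n + 1))} (hS : 0 ∉ S) :
    extAction M w S = q ^ S.card * w S := by
  have key : ∀ T : Finset (Fin (n + 1)), ∀ h : T.card = S.card,
      (Matrix.of fun a b : Fin S.card =>
        M (S.orderEmbOfFin rfl a) (T.orderEmbOfFin h b)).det =
        if S = T then q ^ S.card else 0 := by
    intro T h
    have hne : ∀ a, S.orderEmbOfFin rfl a ≠ 0 := fun a h0 =>
      hS (h0 ▸ S.orderEmbOfFin_mem rfl a)
    simp only [hM _ (hne _)]
    rw [det_ite_eq_of_strictMono (S.orderEmbOfFin rfl).strictMono (T.orderEmbOfFin h).strictMono]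
    simp only [orderEmbOfFin_inj]
  unfold extAction
  rw [Finset.sum_eq_single S]
  · simp [key]
  · intro T _ hT
    split_ifs with h
    · rw [key, if_neg (Ne.symm hT), zero_mul]
    · rfl
  · simp

lemma card_filter_lt_orderEmbOfFin {N k : ℕ} {T : Finset (Fin N)} (hT : T.card = k) (b : Fin k) :
    ((T.erase (T.orderEmbOfFin hT b)).filter (· < T.orderEmbOfFin hT b)).card = b := by
  have : (T.erase (T.orderEmbOfFin hT b)).filter (· < T.orderEmbOfFin hT b) =
      (Finset.Iio b).map (T.orderEmbOfFin hT).toEmbedding := by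
    ext i
    simp only [Finset.mem_filter, Finset.mem_erase, Finset.mem_map, Finset.mem_Iio]
    constructor
    · rintro ⟨⟨-, hi⟩, hlt⟩
      have : i ∈ Set.range (T.orderEmbOfFin hT) := by simpa using hi
      obtain ⟨a, rfl⟩ := this
      exact ⟨a, by simpa using hlt, rfl⟩
    · rintro ⟨a, ha, rfl⟩
      have : T.orderEmbOfFin hT a < T.orderEmbOfFin hT b := by simpa using ha
      exact ⟨⟨this.ne, T.orderEmbOfFin_mem hT a⟩, this⟩
  rw [this, Finset.card_map, Fin.card_Iio]

/-- If the rows of `M` other than the zeroth are those of `q • 1`, then the coordinates of the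
action of `M` indexed by sets containing `0` are given by the map `c`. -/
lemma extAction_apply_insert_zero {n : ℕ} {M : Matrix (Fin (n + 1)) (Fin (n + 1)) ℝ} {q : ℝ}
    (hM : ∀ i ≠ 0, ∀ j, M i j = if j = i then q else 0) (w : Finset (Fin (n + 1)) → ℝ)
    {J : Finset (Fin (n + 1))} (hJ : 0 ∉ J) :
    extAction M w (insert 0 J) = q ^ J.card * ∑ i, M 0 i * cMap w i J := by
  have hS : (insert 0 J).card = J.card + 1 := Finset.card_insert_of_notMem hJ
  set f := (insert 0 J).orderEmbOfFin hS with hf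
  have hf0 : f 0 = 0 := by
    have : (0 : Fin (n + 1)) ∈ Set.range f := by simp [hf]
    obtain ⟨a, ha⟩ := this
    exact le_antisymm (ha ▸ f.monotone (Fin.zero_le a)) (Fin.zero_le _)
  have hfs : ∀ a, f (Fin.succ a) ≠ 0 := fun a h =>
    (Fin.succ_ne_zero a) (f.injective (h.trans hf0.symm))
  have hfJ : (fun a => f (Fin.succ a)) = J.orderEmbOfFin rfl := by
    refine Finset.orderEmbOfFin_unique rfl (fun a => ?_)
      (f.strictMono.comp Fin.strictMono_succ)
    exact Finset.mem_of_mem_insert_of_ne (Finset.orderEmbOfFin_mem _ hS _) (hfs a)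
  let G : Finset (Fin (n + 1)) → Fin (n + 1) → ℝ := fun T i =>
    if J = T.erase i then (-1) ^ (J.filter (· < i)).card * M 0 i * q ^ J.card else 0
  have key : ∀ T : Finset (Fin (n + 1)), ∀ h : T.card = J.card + 1,
      (Matrix.of fun a b : Fin (J.card + 1) => M (f a) (T.orderEmbOfFin h b)).det =
        ∑ i ∈ T, G T i := by
    intro T h
    set g := T.orderEmbOfFin h with hg
    have hT : T = Finset.univ.map g.toEmbedding := by
      ext i
      have : i ∈ Set.range g ↔ i ∈ T := by simp [hg]
      simpa using this.symm
    rw [Matrix.det_succ_row_zero]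
    conv_rhs => rw [hT, Finset.sum_map, ← hT]
    refine Finset.sum_congr rfl fun b _ => ?_
    have hcard : (T.erase (g b)).card = J.card := by
      rw [Finset.card_erase_of_mem (T.orderEmbOfFin_mem h b), h, Nat.add_sub_cancel]
    have hgb : (fun a => g (b.succAbove a)) = (T.erase (g b)).orderEmbOfFin hcard := by
      refine Finset.orderEmbOfFin_unique hcard (fun a => ?_)
        (g.strictMono.comp (Fin.strictMono_succAbove b))
      exact Finset.mem_erase.2 ⟨fun h' => Fin.succAbove_ne b a (g.injective h'),
        T.orderEmbOfFin_mem h _⟩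
    have hsub : ((Matrix.of fun a b : Fin (J.card + 1) => M (f a) (g b)).submatrix Fin.succ
        b.succAbove) = Matrix.of fun a c : Fin J.card =>
          if (T.erase (g b)).orderEmbOfFin hcard c = J.orderEmbOfFin rfl a then q else 0 := by
      ext a c
      simp [hM _ (hfs a), ← hgb, ← hfJ]
    rw [hsub, det_ite_eq_of_strictMono (J.orderEmbOfFin rfl).strictMono
      ((T.erase (g b)).orderEmbOfFin hcard).strictMono]
    simp only [orderEmbOfFin_inj, G, RelEmbedding.coe_toEmbedding, Matrix.of_apply, hf0]
    split_ifs with hJT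
    · have := card_filter_lt_orderEmbOfFin h b
      rw [← hg, ← hJT] at this
      rw [this]
    · simp
  rw [extAction_eq M w hS]
  have hsum : ∀ T : Finset (Fin (n + 1)), (if h : T.card = J.card + 1 then
      (Matrix.of fun a b : Fin (J.card + 1) => M (f a) (T.orderEmbOfFin h b)).det * w T
      else 0) = ∑ i, if i ∈ T then G T i * w T else 0 := by
    intro T
    rw [Finset.sum_ite_mem, Finset.univ_inter]
    split_ifs with h
    · rw [key, Finset.sum_mul]
    · refine (Finset.sum_eq_zero fun i hi => ?_).symm
      have : J ≠ T.erase i := by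
        rintro rfl
        exact h (Finset.card_erase_add_one hi).symm
      simp [G, this]
  rw [Finset.sum_congr rfl fun T _ => hsum T, Finset.sum_comm, Finset.mul_sum]
  refine Finset.sum_congr rfl fun i _ => ?_
  by_cases hi : i ∈ J
  · rw [cMap, if_pos (Or.inr hi), mul_zero, mul_zero]
    refine Finset.sum_eq_zero fun T _ => ?_
    have : J ≠ T.erase i := by
      rintro rfl
      exact Finset.notMem_erase _ _ hi
    simp [G, this]
  · rw [cMap, if_neg (by simp [hi, hJ]), Finset.sum_eq_single (insert i J)]
    · simp only [Finset.mem_insert_self, if_true, G, Finset.erase_insert hi]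
      ring
    · intro T _ hT
      split_ifs with hiT
      · have : J ≠ T.erase i := by
          rintro rfl
          exact hT (Finset.insert_erase hiT).symm
        simp [G, this]
      · rfl
    · simp

lemma gtMat_mul_utMat_of_ne_zero {s m : ℕ} (A : Matrix (Fin (s + 1)) (Fin m) ℝ) (x : Fin s → ℝ)
    (δ T ε : ℝ) (i : Fin (s + m + 1)) (hi : i ≠ 0) (j : Fin (s + m + 1)) :
    (gtMat s m δ T ε * utMat A x) i j = if j = i then ε / T else 0 := by
  have : (i : ℕ) ≠ 0 := fun h => hi (Fin.ext h)
  simp [gtMat, utMat, Matrix.diagonal_mul, this, hi]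

/-- The zeroth row of `g̃_t ũ_x` is `(ε / δ) x̃ R_A`. -/
lemma gtMat_mul_utMat_zero {s m : ℕ} (A : Matrix (Fin (s + 1)) (Fin m) ℝ) (x : Fin s → ℝ)
    (δ T ε : ℝ) (j : Fin (s + m + 1)) :
    (gtMat s m δ T ε * utMat A x) 0 j = ε / δ * ∑ a, tilde x a * RA A a j := by
  simp only [gtMat, utMat, Matrix.diagonal_mul, Fin.coe_ofNat_eq_mod, Nat.zero_mod, if_true]
  congr 1
  obtain ⟨j, hj⟩ := j
  simp only [RA]
  rcases Nat.eq_zero_or_pos j with rfl | hj0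
  · simp [Fin.sum_univ_succ, tilde]
  rw [dif_neg hj0.ne']
  rcases lt_or_ge j (s + 1) with h | h
  · have e : (⟨j - 1, by omega⟩ : Fin (s + m)) = Fin.castAdd m ⟨j - 1, by omega⟩ := rfl
    rw [phiA, e, Fin.append_left, Finset.sum_eq_single (Fin.succ ⟨j - 1, by omega⟩)]
    · have : j - 1 + 1 = j := by omega
      simp only [tilde, Fin.cons_succ]
      simp [h, this]
    · intro b _ hb
      have : j ≠ b := fun h' => hb (Fin.ext (by simp; omega))
      simp [h, this]
    · simp
  · have e : (⟨j - 1, by omega⟩ : Fin (s + m)) = Fin.natAdd s ⟨j - (s + 1), by omega⟩ :=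
      Fin.ext (by simp; omega)
    rw [phiA, e, Fin.append_right]
    simp [not_lt.2 h, Matrix.vecMul, dotProduct]

lemma extAction_gtMat_mul_utMat_insert_zero {s m : ℕ} (A : Matrix (Fin (s + 1)) (Fin m) ℝ)
    (x : Fin s → ℝ) (δ T ε : ℝ) (w : Finset (Fin (s + m + 1)) → ℝ)
    {J : Finset (Fin (s + m + 1))} (hJ : 0 ∉ J) :
    extAction (gtMat s m δ T ε * utMat A x) w (insert 0 J) =
      ε / δ * (ε / T) ^ J.card * ∑ a, tilde x a * RAc A w a J := by
  rw [extAction_apply_insert_zero (gtMat_mul_utMat_of_ne_zero A x δ T ε) w hJ]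
  simp only [gtMat_mul_utMat_zero, RAc, Finset.mul_sum, Finset.sum_mul]
  rw [Finset.sum_comm]
  refine Finset.sum_congr rfl fun a _ => Finset.sum_congr rfl fun i _ => ?_
  ring

lemma abs_le_extNorm {N : ℕ} (w : Finset (Fin N) → ℝ) (S : Finset (Fin N)) :
    |w S| ≤ extNorm w :=
  Real.abs_le_sqrt (Finset.single_le_sum (f := fun S => w S ^ 2) (fun _ _ => sq_nonneg _)
    (Finset.mem_univ S))

lemma mul_pibullNorm_le_extNorm {s m k : ℕ} (A : Matrix (Fin (s + 1)) (Fin m) ℝ)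
    (x : Fin s → ℝ) {δ T ε : ℝ} (hq : 0 ≤ ε / T) {w : Finset (Fin (s + m + 1)) → ℝ}
    (hw : ExtDeg k w) :
    (ε / T) ^ k * pibullNorm s w ≤ extNorm (extAction (gtMat s m δ T ε * utMat A x) w) := by
  rw [pibullNorm, extNorm, ← Real.sqrt_sq (pow_nonneg hq k), ← Real.sqrt_mul (sq_nonneg _),
    Finset.mul_sum]
  refine Real.sqrt_le_sqrt (Finset.sum_le_sum fun S _ => ?_)
  split_ifs with hS
  · have h0 : 0 ∉ S := fun h => by simpa using hS 0 h
    rw [extAction_apply_of_zero_notMem (gtMat_mul_utMat_of_ne_zero A x δ T ε) w h0, ← mul_pow]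
    by_cases hk : S.card = k
    · rw [hk]
    · simp [hw S hk]
  · rw [mul_zero]
    exact sq_nonneg _

lemma RAc_eq_zero {s m k : ℕ} (A : Matrix (Fin (s + 1)) (Fin m) ℝ)
    {w : Finset (Fin (s + m + 1)) → ℝ} (hw : ExtDeg k w) (a : Fin (s + 1))
    {J : Finset (Fin (s + m + 1))} (hJ : 0 ∈ J ∨ J.card + 1 ≠ k) : RAc A w a J = 0 := by
  refine Finset.sum_eq_zero fun i _ => ?_
  rw [cMap]
  split_ifs with h
  · simp
  · push Not at h
    rw [hw, mul_zero, mul_zero]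
    rw [Finset.card_insert_of_notMem h.2]
    exact hJ.resolve_left h.1

/-- An affine function bounded on a ball has bounded coefficients. -/
lemma exists_abs_coeff_le {s : ℕ} (x₀ : EuclideanSpace ℝ (Fin s)) {r : ℝ} (hr : 0 < r) :
    ∃ C > (0 : ℝ), ∀ (B : ℝ) (v : Fin (s + 1) → ℝ),
      (∀ x ∈ ball x₀ r, |∑ a, tilde (fun i => x i) a * v a| ≤ B) → ∀ a, |v a| ≤ C * B := by
  have hX : 0 ≤ ∑ i, |x₀ i| := Finset.sum_nonneg fun _ _ => abs_nonneg _
  refine ⟨1 + 4 / r + (∑ i, |x₀ i|) * (4 / r), by positivity, fun B v hB => ?_⟩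
  have h0 := hB x₀ (mem_ball_self hr)
  have hB0 : 0 ≤ B := (abs_nonneg _).trans h0
  simp only [Fin.sum_univ_succ, tilde, Fin.cons_zero, Fin.cons_succ, one_mul] at h0 hB
  have hs : ∀ i : Fin s, |v i.succ| ≤ 4 / r * B := by
    intro i
    have h1 := hB (x₀ + EuclideanSpace.single i (r / 2)) (by
      simp [mem_ball, dist_eq_norm, abs_of_pos hr]
      linarith)
    simp only [PiLp.add_apply, PiLp.single_apply, add_mul, Finset.sum_add_distrib,
      ite_mul, zero_mul, Finset.sum_ite_eq', Finset.mem_univ, if_true] at h1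
    have h2 : |r / 2 * v i.succ| ≤ 2 * B := by
      rw [abs_le] at *
      constructor <;> linarith
    rw [abs_mul, abs_of_pos (half_pos hr)] at h2
    rw [div_mul_eq_mul_div, le_div_iff₀ hr]
    linarith
  have hz : |v 0| ≤ B + (∑ i, |x₀ i|) * (4 / r * B) := by
    have h3 : |∑ i : Fin s, x₀ i * v i.succ| ≤ (∑ i, |x₀ i|) * (4 / r * B) := by
      refine (Finset.abs_sum_le_sum_abs _ _).trans ?_
      rw [Finset.sum_mul]
      refine Finset.sum_le_sum fun i _ => ?_
      rw [abs_mul]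
      exact mul_le_mul_of_nonneg_left (hs i) (abs_nonneg _)
    rw [abs_le] at *
    constructor <;> linarith
  have hr4 : 0 ≤ 4 / r * B := by positivity
  have hX4 : 0 ≤ (∑ i, |x₀ i|) * (4 / r * B) := by positivity
  intro a
  refine Fin.cases ?_ (fun i => ?_) a
  · linarith
  · linarith [hs i]

lemma RAcNorm_le_of_forall_abs_le {s m : ℕ} (A : Matrix (Fin (s + 1)) (Fin m) ℝ)
    {w : Finset (Fin (s + m + 1)) → ℝ} {b : ℝ} (hb : 0 ≤ b) (h : ∀ a J, |RAc A w a J| ≤ b) :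
    RAcNorm A w ≤ Real.sqrt ((s + 1) * 2 ^ (s + m + 1)) * b := by
  rw [RAcNorm]
  refine (Real.sqrt_le_sqrt (Finset.sum_le_sum fun a _ =>
    Finset.sum_le_card_nsmul _ _ (b ^ 2) fun J _ => sq_le_sq.2 (by
      rw [abs_of_nonneg hb]; exact h a J))).trans ?_
  rw [Finset.sum_const, ← Real.sqrt_sq hb, ← Real.sqrt_mul (by positivity), Real.sqrt_sq hb]
  refine Real.sqrt_le_sqrt (le_of_eq ?_)
  simp
  ring

/-- The norm of `R_A c(w)` is controlled by any bound for `‖g̃_t ũ_x w‖` on a ball. -/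
lemma exists_RAcNorm_le {s m : ℕ} (A : Matrix (Fin (s + 1)) (Fin m) ℝ)
    (x₀ : EuclideanSpace ℝ (Fin s)) {r : ℝ} (hr : 0 < r) :
    ∃ C > (0 : ℝ), ∀ (δ T ε B : ℝ) (k : ℕ) (w : Finset (Fin (s + m + 1)) → ℝ),
      0 < ε / δ → 0 < ε / T → 1 ≤ k → ExtDeg k w →
      (∀ x ∈ ball x₀ r,
        extNorm (extAction (gtMat s m δ T ε * utMat A (fun i => x i)) w) ≤ B) →
      ε / δ * (ε / T) ^ (k - 1) * RAcNorm A w ≤ C * B := by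
  obtain ⟨C, hC, h⟩ := exists_abs_coeff_le x₀ hr
  refine ⟨Real.sqrt ((s + 1) * 2 ^ (s + m + 1)) * C, by positivity,
    fun δ T ε B k w hp hq hk hw hB => ?_⟩
  have hD : 0 < ε / δ * (ε / T) ^ (k - 1) := by positivity
  have hB0 : 0 ≤ B := (Real.sqrt_nonneg _).trans (hB x₀ (mem_ball_self hr))
  have hb : ∀ a J, |RAc A w a J| ≤ C * (B / (ε / δ * (ε / T) ^ (k - 1))) := by
    intro a J
    by_cases hJ : 0 ∈ J ∨ J.card + 1 ≠ k
    · rw [RAc_eq_zero A hw a hJ, abs_zero]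
      positivity
    push Not at hJ
    refine h _ (fun a => RAc A w a J) (fun x hx => ?_) a
    have h1 := (abs_le_extNorm _ (insert 0 J)).trans (hB x hx)
    rw [extAction_gtMat_mul_utMat_insert_zero A _ δ T ε w hJ.1,
      show J.card = k - 1 by omega, abs_mul, abs_of_pos hD] at h1
    rwa [le_div_iff₀' hD]
  have h2 := RAcNorm_le_of_forall_abs_le A (by positivity) hb
  rw [← mul_assoc, ← mul_div_assoc, le_div_iff₀' hD] at h2
  exact h2

lemma continuous_extNorm_extAction {s m : ℕ} (A : Matrix (Fin (s + 1)) (Fin m) ℝ)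
    (δ T ε : ℝ) (w : Finset (Fin (s + m + 1)) → ℝ) :
    Continuous fun x : EuclideanSpace ℝ (Fin s) =>
      extNorm (extAction (gtMat s m δ T ε * utMat A (fun i => x i)) w) := by
  have hM : ∀ i j, Continuous fun x : EuclideanSpace ℝ (Fin s) =>
      (gtMat s m δ T ε * utMat A (fun i => x i)) i j := by
    intro i j
    by_cases hi : i = 0
    · subst hi
      simp only [gtMat_mul_utMat_zero]
      refine continuous_const.mul (continuous_finsetSum _ fun a _ => Continuous.mul ?_
        continuous_const)
      refine Fin.cases ?_ (fun i => ?_) a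
      · simpa [tilde] using continuous_const
      · simp only [tilde, Fin.cons_succ]
        fun_prop
    · simp only [gtMat_mul_utMat_of_ne_zero A _ δ T ε i hi j]
      exact continuous_const
  unfold extNorm extAction
  refine (continuous_finsetSum _ fun S _ => Continuous.pow
    (continuous_finsetSum _ fun S' _ => ?_) 2).sqrt
  split_ifs with h
  · exact (Continuous.matrix_det (continuous_matrix fun a b => hM _ _)).mul continuous_const
  · exact continuous_const

lemma one_le_pibullNorm {s n : ℕ} {w : Finset (Fin (n + 1)) → ℤ}
    (hw : pibullNorm s (fun S => (w S : ℝ)) ≠ 0) : 1 ≤ pibullNorm s (fun S => (w S : ℝ)) := by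
  have hcast : (∑ S : Finset (Fin (n + 1)), if ∀ i ∈ S, s < (i : ℕ) then (w S : ℝ) ^ 2 else 0) =
      ((∑ S : Finset (Fin (n + 1)), if ∀ i ∈ S, s < (i : ℕ) then w S ^ 2 else 0 : ℤ) : ℝ) := by
    push_cast
    rfl
  rw [pibullNorm, hcast] at hw ⊢
  rw [Real.one_le_sqrt]
  have hpos := Real.sqrt_ne_zero'.1 hw
  exact_mod_cast hpos

lemma pibullNorm_const_mul {s n : ℕ} (w : Finset (Fin (n + 1)) → ℝ) {c : ℝ} (hc : 0 ≤ c) :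
    pibullNorm s (fun S => c * w S) = c * pibullNorm s w := by
  rw [pibullNorm, pibullNorm, ← Real.sqrt_sq hc, ← Real.sqrt_mul (sq_nonneg _), Real.sqrt_sq hc,
    Finset.mul_sum]
  congr 1
  refine Finset.sum_congr rfl fun S _ => ?_
  split_ifs <;> ring

lemma RAcNorm_const_mul {s m : ℕ} (A : Matrix (Fin (s + 1)) (Fin m) ℝ)
    (w : Finset (Fin (s + m + 1)) → ℝ) {c : ℝ} (hc : 0 ≤ c) :
    RAcNorm A (fun S => c * w S) = c * RAcNorm A w := by
  have h : ∀ a J, RAc A (fun S => c * w S) a J = c * RAc A w a J := by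
    intro a J
    simp only [RAc, cMap, Finset.mul_sum]
    refine Finset.sum_congr rfl fun i _ => ?_
    split_ifs <;> ring
  simp only [RAcNorm, h, mul_pow, ← Finset.mul_sum]
  rw [Real.sqrt_mul (sq_nonneg _), Real.sqrt_sq hc]

/-- A number that is not an exponent gives a lower bound valid for all integral `w`. -/
lemma exists_mul_rpow_le_RAcNorm {s m j : ℕ} {A : Matrix (Fin (s + 1)) (Fin m) ℝ} {u : ℝ}
    (hu : 0 < u) (hA : u ∉ expSet s m A j) :
    ∃ c > (0 : ℝ), ∀ w : Finset (Fin (s + m + 1)) → ℤ, (∀ S, S.card ≠ j → w S = 0) →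
      pibullNorm s (fun S => (w S : ℝ)) ≠ 0 →
      c * pibullNorm s (fun S => (w S : ℝ)) ^ (-(u + 1 - j) / j) ≤
        RAcNorm A (fun S => (w S : ℝ)) := by
  simp only [expSet, mem_ofPred_eq, not_and, not_forall, not_exists, not_lt] at hA
  obtain ⟨M, hM⟩ := hA hu
  obtain ⟨N, hN⟩ := exists_nat_gt (max M 0)
  have hN0 : (0 : ℝ) < N := (le_max_right _ _).trans_lt hN
  refine ⟨(N : ℝ) ^ (-(u + 1 - j) / j) / N, by positivity, fun w hw hP => ?_⟩
  have hP1 := one_le_pibullNorm hP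
  have h := hM (fun S => N * w S) (fun S hS => by simp [hw S hS])
  push_cast at h
  rw [pibullNorm_const_mul _ hN0.le, RAcNorm_const_mul A _ hN0.le,
    Real.mul_rpow hN0.le (zero_le_one.trans hP1)] at h
  rw [div_mul_eq_mul_div, div_le_iff₀' hN0]
  refine h ((le_max_left M 0).trans_lt (hN.trans_le ?_))
  nlinarith

/-- Eliminating `P` between the two lower bounds for `B`. -/
lemma le_mul_rpow_of_bounds {p q P R B C c u : ℝ} {k : ℕ} (hk : 1 ≤ k) (hku : (k : ℝ) ≤ u + 1)
    (hp : 0 < p) (hq : 0 < q) (hP : 0 < P) (hc : 0 < c) (hB₁ : q ^ k * P ≤ B)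
    (hB₂ : p * q ^ (k - 1) * R ≤ C * B) (hR : c * P ^ (-(u + 1 - k) / k) ≤ R) :
    c * (p * q ^ u) ≤ C * B ^ ((u + 1) / k) := by
  have hk0 : (0 : ℝ) < k := by exact_mod_cast hk
  have hB : 0 < B := (by positivity : 0 < q ^ k * P).trans_le hB₁
  have hα : 0 ≤ (u + 1 - k) / k := div_nonneg (by linarith) hk0.le
  have h1 : q ^ (u + 1 - k) * P ^ ((u + 1 - k) / k) ≤ B ^ ((u + 1 - k) / k) := by
    have := Real.rpow_le_rpow (by positivity) hB₁ hα
    rwa [Real.mul_rpow (by positivity) hP.le, ← Real.rpow_natCast, ← Real.rpow_mul hq.le,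
      mul_div_cancel₀ _ hk0.ne'] at this
  have h2 : p * q ^ (k - 1) * (c * P ^ (-(u + 1 - k) / k)) ≤ C * B :=
    (mul_le_mul_of_nonneg_left hR (by positivity)).trans hB₂
  have h3 := mul_le_mul h1 h2 (by positivity) (by positivity)
  have e1 : q ^ u = q ^ (u + 1 - k) * q ^ (k - 1) := by
    rw [← Real.rpow_natCast, ← Real.rpow_add hq, Nat.cast_sub hk]
    congr 1
    push_cast
    ring
  have e2 : P ^ ((u + 1 - k) / k) * P ^ (-(u + 1 - k) / k) = 1 := by
    rw [← Real.rpow_add hP, neg_div, add_neg_cancel, Real.rpow_zero]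
  have e3 : B ^ ((u + 1) / k) = B ^ ((u + 1 - k) / k) * B := by
    rw [← Real.rpow_add_one hB.ne']
    congr 1
    field_simp
    ring
  calc c * (p * q ^ u) = q ^ (u + 1 - k) * P ^ ((u + 1 - k) / k) *
        (p * q ^ (k - 1) * (c * P ^ (-(u + 1 - k) / k))) := by
        rw [e1]
        linear_combination (-(c * p * q ^ (u + 1 - k) * q ^ (k - 1))) * e2
    _ ≤ B ^ ((u + 1 - k) / k) * (C * B) := h3
    _ = C * B ^ ((u + 1) / k) := by
        rw [e3]
        ring

lemma sqrt_coeff_KofT_pos {s m : ℕ} (hs : 1 ≤ s) {r : ℝ} (hr : 0 < r) :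
    0 < Real.sqrt (((s + m : ℕ) : ℝ) * s / (2 * r ^ 2)) := by
  have : (0 : ℝ) < s := by exact_mod_cast hs
  have : (0 : ℝ) < (s + m : ℕ) := by exact_mod_cast (by omega : 0 < s + m)
  positivity

lemma epsP_pos {s m : ℕ} (hs : 1 ≤ s) {r κ : ℝ} (hr : 0 < r) (hκ : 0 < κ) (β : ℝ) (t : ℕ) :
    0 < epsP s m κ r β t := by
  have := sqrt_coeff_KofT_pos (m := m) hs hr
  unfold epsP epsP' deltaP KofT TofT
  positivity

/-- A lower bound for `(ε / δ) (ε / T) ^ u`, uniform in `κ` and `t`. -/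
lemma le_eps_div_mul_rpow {s m : ℕ} (hs : 1 ≤ s) {r κ β u : ℝ} (hr : 0 < r) (hκ : 0 < κ)
    (hκ1 : κ ≤ 1) (hu : 0 < u) (hun : u < (s + m : ℕ))
    (hβ : 1 / (2 * ((s + m : ℕ) + 1 : ℝ)) - ((s + m : ℕ) - u) / (u + 1) ≤ β) (t : ℕ) :
    (Real.sqrt (((s + m : ℕ) : ℝ) * s / (2 * r ^ 2)) * 2 ^ (s + m - 1)) ^
        ((u + 1) / ((s + m : ℕ) + 1 : ℝ)) * 2 ^ (-u) ≤
      epsP s m κ r β t / deltaP s m κ t * (epsP s m κ r β t / TofT t) ^ u := by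
  set D := Real.sqrt (((s + m : ℕ) : ℝ) * s / (2 * r ^ 2)) with hD
  have hD0 : 0 < D := sqrt_coeff_KofT_pos hs hr
  have hε := epsP_pos (m := m) hs hr hκ β t
  set n := s + m with hn
  have hn1 : 1 ≤ n := by omega
  have hn0 : (0 : ℝ) < (n : ℝ) + 1 := by positivity
  set θ := (u + 1) / ((n : ℝ) + 1) with hθ
  have hθ1 : θ ≤ 1 := (div_le_one hn0).2 (by linarith)
  have hprod : deltaP s m κ t * KofT s m r t * TofT t ^ (n - 1) =
      κ * (D * 2 ^ (n - 1)) * 2 ^ (-(t : ℝ) / 2) := by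
    have h1 : (2 : ℝ) ^ (n * t) = 2 ^ ((n : ℝ) * t) := by
      rw [← Real.rpow_natCast]; push_cast; rfl
    have h2 : ((2 : ℝ) ^ (t + 1)) ^ (n - 1) = 2 ^ (n - 1) * 2 ^ ((t : ℝ) * (n - 1)) := by
      rw [← pow_mul, add_mul, one_mul, pow_add, mul_comm]
      congr 1
      rw [← Real.rpow_natCast]
      push_cast [hn1]
      rfl
    have h3 : (2 : ℝ) ^ ((t : ℝ) / 2) * 2 ^ ((t : ℝ) * (n - 1)) =
        2 ^ (-(t : ℝ) / 2) * 2 ^ ((n : ℝ) * t) := by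
      rw [← Real.rpow_add two_pos, ← Real.rpow_add two_pos]
      congr 1
      ring
    rw [deltaP, KofT, TofT, ← hn, ← hD, h1, h2]
    have h4 : (2 : ℝ) ^ ((n : ℝ) * t) ≠ 0 := by positivity
    rw [div_mul_eq_mul_div, div_mul_eq_mul_div, div_eq_iff h4]
    linear_combination κ * D * 2 ^ (n - 1) * h3
  have hεu : epsP s m κ r β t ^ (u + 1) =
      2 ^ (β * t * (u + 1)) * (κ ^ θ * (D * 2 ^ (n - 1)) ^ θ * 2 ^ (-(t : ℝ) / 2 * θ)) := by
    rw [epsP, epsP', ← hn, hprod, Real.mul_rpow (by positivity) (by positivity),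
      ← Real.rpow_mul zero_le_two, ← Real.rpow_mul (by positivity), one_div_mul_eq_div,
      ← hθ, Real.mul_rpow (by positivity) (by positivity),
      Real.mul_rpow hκ.le (by positivity), ← Real.rpow_mul zero_le_two]
  have hT : (TofT t) ^ (-u) = 2 ^ (-u) * 2 ^ (-(t : ℝ) * u) := by
    rw [TofT, ← Real.rpow_natCast, ← Real.rpow_mul zero_le_two, ← Real.rpow_add two_pos]
    congr 1
    push_cast
    ring
  have hδ : (deltaP s m κ t)⁻¹ = κ⁻¹ * 2 ^ ((n : ℝ) * t) := by
    rw [deltaP, ← hn, inv_div, div_eq_inv_mul, ← Real.rpow_natCast]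
    push_cast
    rfl
  have hT0 : 0 < TofT t := by unfold TofT; positivity
  have hsplit : epsP s m κ r β t / deltaP s m κ t * (epsP s m κ r β t / TofT t) ^ u =
      epsP s m κ r β t ^ (u + 1) * (deltaP s m κ t)⁻¹ * TofT t ^ (-u) := by
    rw [Real.div_rpow hε.le hT0.le, Real.rpow_add_one hε.ne', Real.rpow_neg hT0.le]
    ring
  have hκθ : 1 ≤ κ ^ θ * κ⁻¹ := by
    rw [← Real.rpow_neg_one, ← Real.rpow_add hκ]
    exact Real.one_le_rpow_of_pos_of_le_one_of_nonpos hκ hκ1 (by linarith)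
  have h2pow : 1 ≤ (2 : ℝ) ^ (β * t * (u + 1)) * 2 ^ (-(t : ℝ) / 2 * θ) * 2 ^ ((n : ℝ) * t) *
      2 ^ (-(t : ℝ) * u) := by
    rw [← Real.rpow_add two_pos, ← Real.rpow_add two_pos, ← Real.rpow_add two_pos]
    refine Real.one_le_rpow one_le_two ?_
    have : 0 ≤ β * (u + 1) - θ / 2 + (n - u) := by
      have h5 := mul_le_mul_of_nonneg_right hβ (by linarith : 0 ≤ u + 1)
      have h6 : (1 / (2 * ((n : ℝ) + 1)) - ((n : ℝ) - u) / (u + 1)) * (u + 1) =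
          θ / 2 - (n - u) := by
        rw [hθ]
        field_simp
      linarith
    calc (0 : ℝ) ≤ t * (β * (u + 1) - θ / 2 + (n - u)) := by positivity
      _ = _ := by ring
  rw [hsplit, hεu, hδ, hT]
  calc (D * 2 ^ (n - 1)) ^ θ * 2 ^ (-u) ≤
      (D * 2 ^ (n - 1)) ^ θ * 2 ^ (-u) * ((κ ^ θ * κ⁻¹) *
        ((2 : ℝ) ^ (β * t * (u + 1)) * 2 ^ (-(t : ℝ) / 2 * θ) * 2 ^ ((n : ℝ) * t) *
          2 ^ (-(t : ℝ) * u))) :=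
        le_mul_of_one_le_right (by positivity) (one_le_mul_of_one_le_of_one_le hκθ h2pow)
    _ = _ := by ring

/-- Under the diophantine condition there is a single `u < n` exceeding all the exponents. -/
lemma DiophCond.exists_notMem_expSet {s m : ℕ} {A : Matrix (Fin (s + 1)) (Fin m) ℝ}
    (hA : DiophCond s m A) :
    ∃ u : ℝ, ((s + m : ℕ) : ℝ) - 1 < u ∧ u < (s + m : ℕ) ∧
      ∀ j ∈ Finset.Icc 1 m, u ∉ expSet s m A j := by
  have h : ∀ᶠ u in nhdsWithin ((s + m : ℕ) : ℝ) (Iio ((s + m : ℕ) : ℝ)),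
      ∀ j ∈ Finset.Icc 1 m, u ∉ expSet s m A j := by
    rw [Filter.eventually_all_finset]
    intro j hj
    obtain ⟨v, hv, hvu⟩ := hA j (Finset.mem_Icc.1 hj).1 (Finset.mem_Icc.1 hj).2
    filter_upwards [Ioo_mem_nhdsLT hv] with u hu hmem
    exact (hvu u hmem).not_gt hu.1
  obtain ⟨u, hu, hu'⟩ := (h.and (Ioo_mem_nhdsLT (sub_one_lt ((s + m : ℕ) : ℝ)))).exists
  exact ⟨u, hu'.1, hu'.2, hu⟩

/-- Checking (KM2) in the ranks `1 ≤ k ≤ n - s`: under the diophantine condition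
`ω_j(A) < n`, a suitable `β` and a uniform lower bound `2^{-(n+1)/2} K₅` for
`sup_{x ∈ U} ‖g̃_t ũ_x w‖` (here `n = s + m`). -/
theorem KM2_low_rank (s m : ℕ) (hs : 1 ≤ s) (hm : 1 ≤ m)
    (A : Matrix (Fin (s + 1)) (Fin m) ℝ) (hA : DiophCond s m A)
    (x₀ : EuclideanSpace ℝ (Fin s)) (r : ℝ) (hr : 0 < r) :
    ∃ β ∈ Ioo (0 : ℝ) (1 / (2 * ((s + m : ℕ) + 1 : ℝ))), ∃ K5 > (0 : ℝ),
      ∀ κ : ℝ, 0 < κ → κ ≤ 1 →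
      ∀ t : ℕ, ∀ k : ℕ, 1 ≤ k → k ≤ m →
      ∀ w : Finset (Fin (s + m + 1)) → ℤ,
        (∀ S, S.card ≠ k → w S = 0) →
        pibullNorm s (fun S => (w S : ℝ)) ≠ 0 →
        (2 : ℝ) ^ (-(((s + m : ℕ) : ℝ) + 1) / 2) * K5 ≤
          sSup ((fun x : EuclideanSpace ℝ (Fin s) =>
            extNorm (extAction
              (gtMat s m (deltaP s m κ t) (TofT t) (epsP s m κ r β t) *
                utMat A (fun i => x i)) (fun S => (w S : ℝ)))) '' ball x₀ r) := by
  obtain ⟨u, hu1, hun, hu⟩ := hA.exists_notMem_expSet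
  have hn2 : (m : ℝ) + 1 ≤ (s + m : ℕ) := by exact_mod_cast (by omega : m + 1 ≤ s + m)
  have hm1 : (1 : ℝ) ≤ m := by exact_mod_cast hm
  have hu0 : 0 < u := by linarith
  obtain ⟨C, hC, hCB⟩ := exists_RAcNorm_le A x₀ hr
  have hE := sqrt_coeff_KofT_pos (m := m) hs hr
  set E := (Real.sqrt (((s + m : ℕ) : ℝ) * s / (2 * r ^ 2)) * 2 ^ (s + m - 1)) ^
    ((u + 1) / ((s + m : ℕ) + 1 : ℝ)) * (2 : ℝ) ^ (-u)
  have hE0 : 0 < E := by positivity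
  have hpos : (0 : ℝ) < 1 / (2 * ((s + m : ℕ) + 1 : ℝ)) := by positivity
  have hgap : 0 < (((s + m : ℕ) : ℝ) - u) / (u + 1) := div_pos (by linarith) (by linarith)
  refine ⟨max (1 / (2 * ((s + m : ℕ) + 1 : ℝ)) / 2)
    (1 / (2 * ((s + m : ℕ) + 1 : ℝ)) - ((s + m : ℕ) - u) / (u + 1)),
    ⟨lt_max_of_lt_left (half_pos hpos), max_lt (half_lt_self hpos) (by linarith)⟩, ?_⟩
  set β := max (1 / (2 * ((s + m : ℕ) + 1 : ℝ)) / 2)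
    (1 / (2 * ((s + m : ℕ) + 1 : ℝ)) - ((s + m : ℕ) - u) / (u + 1))
  have key : ∀ k ∈ Finset.Icc 1 m, ∃ b > (0 : ℝ), ∀ κ : ℝ, 0 < κ → κ ≤ 1 → ∀ t : ℕ,
      ∀ w : Finset (Fin (s + m + 1)) → ℤ, (∀ S, S.card ≠ k → w S = 0) →
        pibullNorm s (fun S => (w S : ℝ)) ≠ 0 →
        b ≤ sSup ((fun x : EuclideanSpace ℝ (Fin s) =>
            extNorm (extAction
              (gtMat s m (deltaP s m κ t) (TofT t) (epsP s m κ r β t) *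
                utMat A (fun i => x i)) (fun S => (w S : ℝ)))) '' ball x₀ r) := by
    intro k hk
    obtain ⟨c, hc, hcR⟩ := exists_mul_rpow_le_RAcNorm hu0 (hu k hk)
    rw [Finset.mem_Icc] at hk
    have hk0 : (0 : ℝ) < k := by exact_mod_cast hk.1
    have hkm : (k : ℝ) ≤ m := by exact_mod_cast hk.2
    refine ⟨(c * E / C) ^ (k / (u + 1)), by positivity, fun κ hκ hκ1 t w hw hP => ?_⟩
    have hε := epsP_pos (m := m) hs hr hκ β t
    have hδ : 0 < deltaP s m κ t := by unfold deltaP; positivity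
    have hT : 0 < TofT t := by unfold TofT; positivity
    have hdeg : ExtDeg k fun S => (w S : ℝ) := fun S hS => by simp [hw S hS]
    set F := fun x : EuclideanSpace ℝ (Fin s) => extNorm (extAction
      (gtMat s m (deltaP s m κ t) (TofT t) (epsP s m κ r β t) *
        utMat A (fun i => x i)) (fun S => (w S : ℝ)))
    have hbdd : BddAbove (F '' ball x₀ r) :=
      ((isCompact_closedBall x₀ r).bddAbove_image
        (continuous_extNorm_extAction A _ _ _ _).continuousOn).mono
        (image_mono ball_subset_closedBall)
    have hF : ∀ x ∈ ball x₀ r, F x ≤ sSup (F '' ball x₀ r) := fun x hx =>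
      le_csSup hbdd (mem_image_of_mem F hx)
    have hP0 := zero_lt_one.trans_le (one_le_pibullNorm hP)
    have h1 := (mul_pibullNorm_le_extNorm A (fun i => x₀ i) (div_pos hε hT).le hdeg).trans
      (hF x₀ (mem_ball_self hr))
    have h2 := hCB _ _ _ _ k _ (div_pos hε hδ) (div_pos hε hT) hk.1 hdeg hF
    have h3 := le_mul_rpow_of_bounds hk.1 (by linarith) (div_pos hε hδ) (div_pos hε hT) hP0 hc
      h1 h2 (hcR w hw hP)
    have h4 := (mul_le_mul_of_nonneg_left
      (le_eps_div_mul_rpow hs hr hκ hκ1 hu0 hun (le_max_right _ _) t) hc.le).trans h3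
    have hB : 0 ≤ sSup (F '' ball x₀ r) :=
      (Real.sqrt_nonneg _).trans (hF x₀ (mem_ball_self hr))
    calc (c * E / C) ^ (k / (u + 1))
        ≤ (sSup (F '' ball x₀ r) ^ ((u + 1) / k)) ^ (k / (u + 1)) :=
          Real.rpow_le_rpow (by positivity) ((div_le_iff₀' hC).2 h4) (by positivity)
      _ = sSup (F '' ball x₀ r) := by
          rw [← Real.rpow_mul hB, div_mul_div_cancel₀ hk0.ne', div_self (by linarith),
            Real.rpow_one]
  choose! b hb hbound using key
  have hev : ∀ᶠ K in nhdsWithin (0 : ℝ) (Ioi 0), ∀ k ∈ Finset.Icc 1 m, K ≤ b k := by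
    rw [Filter.eventually_all_finset]
    intro k hk
    filter_upwards [Ioo_mem_nhdsGT (hb k hk)] with K hK
    exact hK.2.le
  obtain ⟨K, hK, hK0⟩ := (hev.and self_mem_nhdsWithin).exists
  refine ⟨K, hK0, fun κ hκ hκ1 t k hk hkm w hw hP => ?_⟩
  have hkI : k ∈ Finset.Icc 1 m := Finset.mem_Icc.2 ⟨hk, hkm⟩
  refine le_trans ?_ ((hK k hkI).trans (hbound k hkI κ hκ hκ1 t w hw hP))
  refine mul_le_of_le_one_left (le_of_lt hK0) (Real.rpow_le_one_of_one_le_of_nonpos one_le_two ?_)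
  have : (0 : ℝ) ≤ (s + m : ℕ) := Nat.cast_nonneg _
  linarith

end
end

section
/- With the setup in the context, assume ω_j(A) < n for every j = 1, …, n−s and 0 < κ ≤ min{1, r/(2^{n−3/2}√(ns))}. Then there exist β ∈ (0, 1/(2(n+1))) and an explicit constant K_0 > 0, both depending only on s, n, U and A, such that for every t ∈ ℤ_{≥0}, the set Ã_t := {x ∈ U : ‖g_t u_x λ‖ < ε for some λ ∈ Λ∖{0}} satisfies |Ã_t| ≤ K_0 · κ^{1/(s(n+1))} · 2^{−((1/(2(n+1)) − β)/s) t} · |U|. -/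
open MeasureTheory Metric Set
open scoped BigOperators ENNReal

noncomputable section

lemma abs_det_le_of_columns {j : ℕ} (M : Matrix (Fin j) (Fin j) ℝ) (c : Fin j → ℝ)
    (h : ∀ k i, |M k i| ≤ c i) : |M.det| ≤ (j.factorial : ℝ) * ∏ i, c i := by
  rw [Matrix.det_apply']
  refine (Finset.abs_sum_le_sum_abs _ _).trans ?_
  have : ∀ σ ∈ (Finset.univ : Finset (Equiv.Perm (Fin j))),
      |((Equiv.Perm.sign σ : ℤ) : ℝ) * ∏ i, M (σ i) i| ≤ ∏ i, c i := by
    intro σ _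
    rw [abs_mul, Finset.abs_prod]
    have h1 : |((Equiv.Perm.sign σ : ℤ) : ℝ)| = 1 := by
      rcases Int.units_eq_one_or (Equiv.Perm.sign σ) with h | h <;> simp [h]
    rw [h1, one_mul]
    exact Finset.prod_le_prod (fun _ _ => abs_nonneg _) (fun i _ => h _ _)
  refine (Finset.sum_le_sum this).trans ?_
  simp [Fintype.card_perm]

lemma exists_det_ne_zero_of_span_eq_top {j : ℕ} (S : Finset (Fin j → ℤ))
    (hS : Submodule.span ℤ (S : Set (Fin j → ℤ)) = ⊤) :
    ∃ w : Fin j → Fin j → ℤ, (∀ i, w i ∈ S) ∧ (Matrix.of w).det ≠ 0 := by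
  let c : (Fin j → ℤ) →ₗ[ℤ] (Fin j → ℚ) :=
    LinearMap.compLeft (Algebra.linearMap ℤ ℚ) (Fin j)
  have hc : ∀ x i, c x i = (x i : ℚ) := fun x i => rfl
  have htop : Submodule.span ℚ (c '' (S : Set (Fin j → ℤ))) = ⊤ := by
    have key : ∀ x : Fin j → ℤ, c x ∈ Submodule.span ℚ (c '' (S : Set (Fin j → ℤ))) := by
      intro x
      have hx : x ∈ Submodule.span ℤ (S : Set (Fin j → ℤ)) := hS ▸ Submodule.mem_top
      have h2 := Submodule.mem_map_of_mem (f := c) hx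
      rw [Submodule.map_span] at h2
      exact Submodule.span_le_restrictScalars ℤ ℚ _ h2
    rw [eq_top_iff]
    intro y _
    have : y = ∑ i, y i • c (Pi.single i 1) := by
      ext k
      simp [hc, Finset.sum_apply, Pi.single_apply]
    rw [this]
    exact Submodule.sum_mem _ fun i _ => Submodule.smul_mem _ _ (key _)
  have hr : Module.finrank ℚ (Submodule.span ℚ (c '' (S : Set (Fin j → ℤ)))) = j := by
    rw [htop]; simp
  have H := Submodule.exists_fun_fin_finrank_span_eq ℚ (c '' (S : Set (Fin j → ℤ)))
  rw [hr] at H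
  obtain ⟨f, hf, -, hli⟩ := H
  choose w hwS hwf using hf
  refine ⟨w, hwS, fun h0 => ?_⟩
  have hf' : (Matrix.of f) = (Matrix.of w).map (Int.castRingHom ℚ) := by
    ext i k
    simp [← hwf, hc]
  have hu : IsUnit (Matrix.of f) := Matrix.linearIndependent_rows_iff_isUnit.1 hli
  rw [Matrix.isUnit_iff_isUnit_det, hf', ← RingHom.mapMatrix_apply, ← RingHom.map_det, h0] at hu
  simp at hu

lemma card_le_of_span_eq_top {j : ℕ} (S : Finset (Fin j → ℤ))
    (hS : Submodule.span ℤ (S : Set (Fin j → ℤ)) = ⊤) :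
    ∃ w : Fin j → Fin j → ℤ, (∀ i, w i ∈ S) ∧
      S.card ≤ 3 ^ j * (Matrix.of w).det.natAbs := by
  obtain ⟨w0, hw0, hd0⟩ := exists_det_ne_zero_of_span_eq_top S hS
  obtain ⟨w, hw, hmax⟩ := Finset.exists_max_image (Fintype.piFinset fun _ : Fin j => S)
    (fun w => (Matrix.of w).det.natAbs) ⟨w0, by simpa using hw0⟩
  have hwS : ∀ i, w i ∈ S := by simpa using hw
  have hd : (Matrix.of w).det ≠ 0 := by
    have := hmax w0 (by simpa using hw0)
    intro h
    rw [h] at this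
    simp at this
    exact hd0 this
  refine ⟨w, hwS, ?_⟩
  set B : Matrix (Fin j) (Fin j) ℤ := (Matrix.of w).transpose with hB
  have hBdet : B.det = (Matrix.of w).det := Matrix.det_transpose _
  have hBinj : Function.Injective (Matrix.mulVecLin B) := by
    intro x y hxy
    have : B.mulVec x = B.mulVec y := hxy
    have h2 := congrArg (B.adjugate.mulVec) this
    simp only [Matrix.mulVec_mulVec, Matrix.adjugate_mul, Matrix.smul_mulVec,
      Matrix.one_mulVec] at h2
    exact smul_right_injective _ (by rw [hBdet]; exact hd) h2
  let N := LinearMap.range (Matrix.mulVecLin B)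
  let e : (Fin j → ℤ) ≃ₗ[ℤ] N := LinearEquiv.ofInjective _ hBinj
  have hcard : B.det.natAbs = Nat.card ((Fin j → ℤ) ⧸ N) := by
    rw [← Submodule.natAbs_det_equiv N e]
    congr 1
    rw [← LinearMap.det_toLin']
    congr 1
  have hfin : Finite ((Fin j → ℤ) ⧸ N) := by
    apply Nat.finite_of_card_ne_zero
    rw [← hcard, hBdet]
    simpa using hd
  have hcr : ∀ x ∈ S, ∀ i, |Matrix.cramer B x i| ≤ |B.det| := by
    intro x hx i
    rw [hB, Matrix.cramer_transpose_apply, Matrix.det_transpose]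
    have h1 := hmax (Function.update w i x) (by
      simp only [Fintype.mem_piFinset]
      intro k
      by_cases hk : k = i
      · subst hk; simpa using hx
      · simpa [hk] using hwS k)
    have h2 : Matrix.of (Function.update w i x) = (Matrix.of w).updateRow i x := rfl
    rw [h2] at h1
    zify at h1
    exact h1
  let φ : (Fin j → ℤ) → ((Fin j → ℤ) ⧸ N) × (Fin j → Finset.Icc (-1 : ℤ) 1) := fun x =>
    (Submodule.Quotient.mk x, fun i => if h : Matrix.cramer B x i / B.det ∈ Finset.Icc (-1 : ℤ) 1
      then ⟨_, h⟩ else ⟨0, by simp⟩)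
  have hmem : ∀ x ∈ S, ∀ i, Matrix.cramer B x i / B.det ∈ Finset.Icc (-1 : ℤ) 1 := by
    intro x hx i
    have h1 := abs_le.1 (hcr x hx i)
    have hD : B.det ≠ 0 := by rw [hBdet]; exact hd
    generalize Matrix.cramer B x i = c at h1
    generalize B.det = D at h1 hD
    rw [Finset.mem_Icc]
    rcases lt_or_gt_of_ne hD with h | h
    · rw [abs_of_neg h] at h1
      have := Int.emod_add_mul_ediv c D
      have h3 := Int.emod_nonneg c hD
      have h4 := Int.emod_lt_abs c hD
      rw [abs_of_neg h] at h4
      constructor <;> nlinarith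
    · rw [abs_of_pos h] at h1
      have := Int.emod_add_mul_ediv c D
      have h3 := Int.emod_nonneg c hD
      have h4 := Int.emod_lt_abs c hD
      rw [abs_of_pos h] at h4
      constructor <;> nlinarith
  have hφ : Set.InjOn φ (S : Set (Fin j → ℤ)) := by
    intro x hx y hy hxy
    have h1 := congrArg Prod.fst hxy
    have h2 := congrArg Prod.snd hxy
    simp only [φ] at h1 h2
    rw [Submodule.Quotient.eq] at h1
    obtain ⟨z, hz⟩ := h1
    have hz' : B.mulVec z = x - y := hz
    have hcz : Matrix.cramer B x - Matrix.cramer B y = B.det • z := by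
      rw [← map_sub, ← hz', Matrix.cramer_eq_adjugate_mulVec, Matrix.mulVec_mulVec,
        Matrix.adjugate_mul, Matrix.smul_mulVec, Matrix.one_mulVec]
    have hz0 : z = 0 := by
      ext i
      have h3 := congrFun h2 i
      rw [dif_pos (hmem x hx i), dif_pos (hmem y hy i)] at h3
      have h4 : Matrix.cramer B x i / B.det = Matrix.cramer B y i / B.det := by
        simpa using h3
      have h5 := congrFun hcz i
      simp only [Pi.sub_apply, Pi.smul_apply, smul_eq_mul] at h5
      have h6 : Matrix.cramer B x i = Matrix.cramer B y i + B.det * z i := by linarith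
      rw [h6, Int.add_mul_ediv_left _ _ (by rw [hBdet]; exact hd)] at h4
      simpa using h4
    rw [hz0, Matrix.mulVec_zero] at hz'
    exact (sub_eq_zero.1 hz'.symm)
  have := Fintype.ofFinite ((Fin j → ℤ) ⧸ N)
  have hle := Finset.card_le_card_of_injOn (t := Finset.univ) φ (fun _ _ => Finset.mem_univ _) hφ
  rw [Finset.card_univ, Fintype.card_prod, Fintype.card_fun, ← Nat.card_eq_fintype_card,
    ← hcard, hBdet] at hle
  simp at hle
  linarith

/-- The wedge of integer vectors, in coordinates. -/
def wedgeInt {N k : ℕ} (v : Fin k → Fin N → ℤ) (S : Finset (Fin N)) : ℤ :=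
  if h : S.card = k then
    (Matrix.of fun a b : Fin k => v a (S.orderEmbOfFin h b)).det
  else 0

lemma cast_wedgeInt {N k : ℕ} (v : Fin k → Fin N → ℤ) (S : Finset (Fin N)) :
    ((wedgeInt v S : ℤ) : ℝ) = wedgeOf (fun a i => (v a i : ℝ)) S := by
  unfold wedgeInt wedgeOf
  split_ifs with h
  · rw [Int.cast_det]
    rfl
  · simp

lemma exists_wedgeInt_ne_zero {N j : ℕ} (b : Fin j → Fin N → ℤ) (hb : LinearIndependent ℤ b) :
    ∃ J, wedgeInt b J ≠ 0 := by
  let B : Matrix (Fin j) (Fin N) ℚ := Matrix.of fun a i => (b a i : ℚ)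
  have hB : LinearIndependent ℚ B.row := by
    rw [← LinearIndependent.iff_fractionRing ℤ ℚ]
    let c : (Fin N → ℤ) →ₗ[ℤ] (Fin N → ℚ) :=
      LinearMap.compLeft (Algebra.linearMap ℤ ℚ) (Fin N)
    have hc : Function.Injective c := by
      intro x y h
      ext i
      have := congrFun h i
      exact Int.cast_injective (α := ℚ) this
    exact hb.map' c (LinearMap.ker_eq_bot.2 hc)
  have hr : Module.finrank ℚ (Submodule.span ℚ (Set.range B.col)) = j := by
    rw [← Matrix.rank_eq_finrank_span_cols, hB.rank_matrix]
    simp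
  have H := Submodule.exists_fun_fin_finrank_span_eq ℚ (Set.range B.col)
  rw [hr] at H
  obtain ⟨f, hf, -, hli⟩ := H
  choose g hg using hf
  have hginj : Function.Injective g := fun x y h => hli.injective (by rw [← hg, ← hg, h])
  have hcard : (Finset.univ.image g).card = j := by
    rw [Finset.card_image_of_injective _ hginj]; simp
  refine ⟨Finset.univ.image g, ?_⟩
  have hσ : ∀ k, ∃ i, g i = (Finset.univ.image g).orderEmbOfFin hcard k := by
    intro k
    obtain ⟨i, -, hi⟩ := Finset.mem_image.1
      (Finset.orderEmbOfFin_mem (Finset.univ.image g) hcard k)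
    exact ⟨i, hi⟩
  choose σ hσ using hσ
  have hσinj : Function.Injective σ := fun x y h =>
    ((Finset.univ.image g).orderEmbOfFin hcard).injective (by rw [← hσ, ← hσ, h])
  have hli2 := hli.comp σ hσinj
  unfold wedgeInt
  rw [dif_pos hcard]
  intro h0
  set M := (Matrix.of fun a c : Fin j => b a ((Finset.univ.image g).orderEmbOfFin hcard c))
  have hM : LinearIndependent ℚ (M.map (Int.castRingHom ℚ)).col := by
    have he : (M.map (Int.castRingHom ℚ)).col = f ∘ σ := by
      ext k a
      simp only [Function.comp, ← hg, M, ← hσ]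
      rfl
    rw [he]
    exact hli2
  have hu := Matrix.linearIndependent_cols_iff_isUnit.1 hM
  rw [Matrix.isUnit_iff_isUnit_det, ← RingHom.mapMatrix_apply, ← RingHom.map_det, h0] at hu
  simp at hu

lemma exists_wedge_card_le {N : ℕ} (S : Finset (Fin N → ℤ)) (hS : ∃ x ∈ S, x ≠ 0) :
    ∃ j : ℕ, 1 ≤ j ∧ j ≤ N ∧ ∃ (w b : Fin j → Fin N → ℤ) (D : ℤ), (∀ i, w i ∈ S) ∧
      S.card ≤ 3 ^ j * D.natAbs ∧ (∀ J, wedgeInt w J = D * wedgeInt b J) ∧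
      ∃ J, wedgeInt b J ≠ 0 := by
  classical
  let Γ : Submodule ℤ (Fin N → ℤ) := Submodule.span ℤ (S : Set (Fin N → ℤ))
  let j := Module.finrank ℤ Γ
  let β : Module.Basis (Fin j) ℤ Γ := Module.finBasis ℤ Γ
  have hsub : ∀ x ∈ S, x ∈ Γ := fun x hx => Submodule.subset_span hx
  let ι : S → Fin j → ℤ := fun x => β.equivFun ⟨x.1, hsub x.1 x.2⟩
  have hι : Function.Injective ι := by
    intro x y h
    have := β.equivFun.injective h
    exact Subtype.ext (by simpa using this)
  let S' : Finset (Fin j → ℤ) := Finset.univ.image ι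
  have hS'c : S'.card = S.card := by
    rw [Finset.card_image_of_injective _ hι]; simp
  have hspan : Submodule.span ℤ (S' : Set (Fin j → ℤ)) = ⊤ := by
    have h1 := Submodule.span_span_coe_preimage (R := ℤ) (s := (S : Set (Fin N → ℤ)))
    have h2 := congrArg (Submodule.map (β.equivFun : Γ →ₗ[ℤ] (Fin j → ℤ))) h1
    rw [Submodule.map_span, Submodule.map_top, LinearEquiv.range] at h2
    rw [← h2]
    congr 1
    ext y
    simp only [S', ι, Finset.coe_image, Finset.coe_univ, Set.image_univ, Set.mem_range,
      Set.mem_image, Set.mem_preimage]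
    constructor
    · rintro ⟨x, rfl⟩
      exact ⟨⟨x.1, hsub x.1 x.2⟩, x.2, rfl⟩
    · rintro ⟨x, hx, rfl⟩
      exact ⟨⟨x.1, hx⟩, rfl⟩
  obtain ⟨w', hw', hcard⟩ := card_le_of_span_eq_top S' hspan
  have hw'' : ∀ i, ∃ x : S, ι x = w' i := by
    intro i
    simpa [S'] using hw' i
  choose x hx using hw''
  let b : Fin j → Fin N → ℤ := fun a => (β a : Fin N → ℤ)
  have hbli : LinearIndependent ℤ b :=
    β.linearIndependent.map' Γ.subtype (Submodule.ker_subtype _)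
  obtain ⟨J0, hJ0⟩ := exists_wedgeInt_ne_zero b hbli
  have hjc : J0.card = j := by
    by_contra h
    exact hJ0 (by unfold wedgeInt; rw [dif_neg h])
  refine ⟨j, ?_, ?_, fun i => (x i).1, b, (Matrix.of w').det, fun i => (x i).2, ?_, ?_, J0, hJ0⟩
  · obtain ⟨y, hy, hy0⟩ := hS
    have : Nontrivial Γ := ⟨⟨⟨y, hsub y hy⟩, 0, fun h => hy0 (congrArg Subtype.val h)⟩⟩
    exact Module.finrank_pos
  · rw [← hjc]
    simpa using Finset.card_le_univ J0
  · rw [← hS'c]; exact hcard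
  · intro J
    unfold wedgeInt
    split_ifs with h
    · rw [← Matrix.det_mul]
      congr 1
      ext a c
      have h1 : (⟨(x a).1, hsub _ (x a).2⟩ : Γ) = ∑ k, w' a k • β k := by
        rw [← hx]
        exact (β.sum_equivFun _).symm
      have h2 := congrArg (fun z : Γ => (z : Fin N → ℤ) (J.orderEmbOfFin h c)) h1
      simp only [Submodule.coe_sum, Submodule.coe_smul, Finset.sum_apply, Pi.smul_apply,
        smul_eq_mul] at h2
      rw [Matrix.mul_apply]
      exact h2
    · simp

lemma cMap_wedgeOf {n k : ℕ} (v : Fin (k + 1) → Fin (n + 1) → ℝ) (i : Fin (n + 1))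
    (J : Finset (Fin (n + 1))) (hJ : J.card = k) (h0 : (0 : Fin (n + 1)) ∉ J) :
    cMap (wedgeOf v) i J = ∑ r : Fin (k + 1), (-1 : ℝ) ^ (r : ℕ) * v r i *
      (Matrix.of fun a c : Fin k => v (r.succAbove a) (J.orderEmbOfFin hJ c)).det := by
  unfold cMap
  by_cases hi : i ∈ J
  · rw [if_pos (Or.inr hi)]
    let M : Matrix (Fin (k + 1)) (Fin (k + 1)) ℝ :=
      Matrix.of fun r => Fin.cons (v r i) fun c => v r (J.orderEmbOfFin hJ c)
    obtain ⟨c, hc⟩ : ∃ c, J.orderEmbOfFin hJ c = i := by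
      have : i ∈ Set.range (J.orderEmbOfFin hJ) := by
        rw [Finset.range_orderEmbOfFin]; exact hi
      exact this
    have hM : M.det = 0 := by
      refine Matrix.det_zero_of_column_eq (i := 0) (j := c.succ) (Fin.succ_ne_zero c).symm ?_
      intro r
      simp [M, hc]
    rw [Matrix.det_succ_column_zero] at hM
    rw [← hM]
    refine Finset.sum_congr rfl fun r _ => ?_
    congr 1
  · rw [if_neg (by simp [h0, hi])]
    have hc : (insert i J).card = k + 1 := by rw [Finset.card_insert_of_notMem hi, hJ]
    unfold wedgeOf
    rw [dif_pos hc]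
    set e := (insert i J).orderEmbOfFin hc with he
    obtain ⟨p, hp⟩ : ∃ p, e p = i := by
      have : i ∈ Set.range e := by
        rw [he, Finset.range_orderEmbOfFin]; simp
      exact this
    have hcomp : ∀ c, e (p.succAbove c) = J.orderEmbOfFin hJ c := by
      intro c
      refine congrFun (Finset.orderEmbOfFin_unique hJ (f := fun c => e (p.succAbove c)) ?_ ?_) c
      · intro c
        have h1 : e (p.succAbove c) ∈ insert i J := Finset.orderEmbOfFin_mem _ _ _
        refine Finset.mem_of_mem_insert_of_ne h1 ?_
        rw [← hp]
        exact fun h => Fin.succAbove_ne p c (e.injective h)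
      · intro a b hab
        exact e.strictMono (Fin.strictMono_succAbove p hab)
    have hfil : (J.filter (· < i)).card = (p : ℕ) := by
      have : J.filter (· < i) = (Finset.Iio p).map e.toEmbedding := by
        ext x
        simp only [Finset.mem_filter, Finset.mem_map, Finset.mem_Iio]
        constructor
        · rintro ⟨hx, hxi⟩
          have : x ∈ Set.range e := by
            rw [he, Finset.range_orderEmbOfFin]; simp [hx]
          obtain ⟨q, rfl⟩ := this
          refine ⟨q, ?_, rfl⟩
          rw [← hp] at hxi
          exact e.lt_iff_lt.1 hxi
        · rintro ⟨q, hq, rfl⟩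
          have hlt : e q < i := by rw [← hp]; exact e.lt_iff_lt.2 hq
          refine ⟨?_, hlt⟩
          have h1 : e q ∈ insert i J := Finset.orderEmbOfFin_mem _ _ _
          exact Finset.mem_of_mem_insert_of_ne h1 hlt.ne
      rw [this, Finset.card_map, Fin.card_Iio]
    rw [hfil, Matrix.det_succ_column _ p, Finset.mul_sum]
    refine Finset.sum_congr rfl fun r _ => ?_
    have hsub : ((Matrix.of fun a b => v a (e b)).submatrix r.succAbove p.succAbove) =
        Matrix.of fun a c : Fin k => v (r.succAbove a) (J.orderEmbOfFin hJ c) := by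
      ext a c
      simp [hcomp]
    rw [hsub]
    simp only [Matrix.of_apply, hp]
    have hsq : (-1 : ℝ) ^ (p : ℕ) * (-1) ^ (p : ℕ) = 1 := by
      rw [← mul_pow]; simp
    rw [pow_add]
    linear_combination (-1 : ℝ) ^ (r : ℕ) * v r i *
      (Matrix.of fun a c : Fin k => v (r.succAbove a) (J.orderEmbOfFin hJ c)).det * hsq

lemma abs_RAc_wedgeOf_le {s m k : ℕ} (A : Matrix (Fin (s + 1)) (Fin m) ℝ)
    (v : Fin (k + 1) → Fin (s + m + 1) → ℝ) {η T : ℝ} (hη : 0 ≤ η) (hT : 0 ≤ T)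
    (hR : ∀ r a, |∑ i, RA A a i * v r i| ≤ η) (hv : ∀ r i, i ≠ 0 → |v r i| ≤ T)
    (a : Fin (s + 1)) (J : Finset (Fin (s + m + 1))) :
    |RAc A (wedgeOf v) a J| ≤ (k + 1) * (η * (k.factorial * T ^ k)) := by
  have hnn : 0 ≤ ((k : ℝ) + 1) * (η * (k.factorial * T ^ k)) := by positivity
  unfold RAc
  by_cases h0 : (0 : Fin (s + m + 1)) ∈ J
  · simpa [cMap, h0] using hnn
  by_cases hJ : J.card = k
  · have h1 : ∑ i, RA A a i * cMap (wedgeOf v) i J = ∑ r : Fin (k + 1), (-1 : ℝ) ^ (r : ℕ) *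
        (∑ i, RA A a i * v r i) *
        (Matrix.of fun a c : Fin k => v (r.succAbove a) (J.orderEmbOfFin hJ c)).det := by
      simp_rw [cMap_wedgeOf v _ J hJ h0, Finset.mul_sum, Finset.sum_mul]
      rw [Finset.sum_comm]
      refine Finset.sum_congr rfl fun r _ => Finset.sum_congr rfl fun i _ => ?_
      ring
    rw [h1]
    refine (Finset.abs_sum_le_sum_abs _ _).trans ?_
    have h2 : ∀ r ∈ (Finset.univ : Finset (Fin (k + 1))), |(-1 : ℝ) ^ (r : ℕ) *
        (∑ i, RA A a i * v r i) *
        (Matrix.of fun a c : Fin k => v (r.succAbove a) (J.orderEmbOfFin hJ c)).det| ≤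
        η * (k.factorial * T ^ k) := by
      intro r _
      rw [abs_mul, abs_mul, abs_pow, abs_neg, abs_one, one_pow, one_mul]
      refine mul_le_mul (hR r a) ?_ (abs_nonneg _) hη
      refine (abs_det_le_of_columns _ (fun _ => T) fun x c => ?_).trans (by simp)
      refine hv _ _ fun h => h0 ?_
      rw [← h]
      exact Finset.orderEmbOfFin_mem _ _ _
    refine (Finset.sum_le_sum h2).trans ?_
    simp
  · have h1 : ∀ i, cMap (wedgeOf v) i J = 0 := by
      intro i
      unfold cMap
      split_ifs with h
      · rfl
      · have : (insert i J).card ≠ k + 1 := by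
          rw [Finset.card_insert_of_notMem (by tauto)]; omega
        simp [wedgeOf, this]
    simpa [h1] using hnn

lemma sqrt_sum_sq_le {ι : Type*} (S : Finset ι) (f : ι → ℝ) :
    Real.sqrt (∑ i ∈ S, f i ^ 2) ≤ ∑ i ∈ S, |f i| := by
  rw [Real.sqrt_le_left (Finset.sum_nonneg fun _ _ => abs_nonneg _)]
  simp_rw [← sq_abs (f _)]
  exact Finset.sum_sq_le_sq_sum_of_nonneg fun _ _ => abs_nonneg _

lemma RAcNorm_le {s m : ℕ} (A : Matrix (Fin (s + 1)) (Fin m) ℝ)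
    (w : Finset (Fin (s + m + 1)) → ℝ) {B : ℝ} (hB : ∀ a J, |RAc A w a J| ≤ B) :
    RAcNorm A w ≤ (s + 1) * 2 ^ (s + m + 1) * B := by
  unfold RAcNorm
  rw [← Finset.sum_product']
  refine (sqrt_sum_sq_le _ _).trans ?_
  refine (Finset.sum_le_sum (g := fun _ => B) fun x _ => hB _ _).trans ?_
  simp

lemma abs_RAc_le_RAcNorm {s m : ℕ} (A : Matrix (Fin (s + 1)) (Fin m) ℝ)
    (w : Finset (Fin (s + m + 1)) → ℝ) (a : Fin (s + 1)) (J : Finset (Fin (s + m + 1))) :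
    |RAc A w a J| ≤ RAcNorm A w := by
  unfold RAcNorm
  rw [← Finset.sum_product']
  apply Real.abs_le_sqrt
  exact Finset.single_le_sum (f := fun x : Fin (s + 1) × Finset (Fin (s + m + 1)) =>
    RAc A w x.1 x.2 ^ 2) (fun _ _ => sq_nonneg _) (Finset.mem_univ (a, J))

lemma pibullNorm_wedgeOf_le {s n k : ℕ} (v : Fin k → Fin (n + 1) → ℝ) {T : ℝ} (hT : 0 ≤ T)
    (hv : ∀ r i, i ≠ 0 → |v r i| ≤ T) :
    pibullNorm s (wedgeOf v) ≤ 2 ^ (n + 1) * (k.factorial * T ^ k) := by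
  unfold pibullNorm
  have h1 : ∀ S : Finset (Fin (n + 1)), (if ∀ i ∈ S, s < (i : ℕ) then (wedgeOf v S) ^ 2 else 0) =
      (if ∀ i ∈ S, s < (i : ℕ) then wedgeOf v S else 0) ^ 2 := by
    intro S; split_ifs <;> simp
  simp_rw [h1]
  refine (sqrt_sum_sq_le _ _).trans ?_
  refine (Finset.sum_le_sum (g := fun _ => (k.factorial * T ^ k : ℝ)) fun S _ => ?_).trans ?_
  · split_ifs with h
    · unfold wedgeOf
      split_ifs with hc
      · refine (abs_det_le_of_columns _ (fun _ => T) fun x c => ?_).trans (by simp)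
        refine hv _ _ fun h0 => ?_
        have := h _ (Finset.orderEmbOfFin_mem S hc c)
        rw [h0] at this
        simp at this
      · rw [abs_zero]; positivity
    · rw [abs_zero]; positivity
  · simp

lemma abs_le_pibullNorm {s n : ℕ} (w : Finset (Fin (n + 1)) → ℝ) (S : Finset (Fin (n + 1)))
    (hS : ∀ i ∈ S, s < (i : ℕ)) : |w S| ≤ pibullNorm s w := by
  unfold pibullNorm
  apply Real.abs_le_sqrt
  have := Finset.single_le_sum (f := fun S : Finset (Fin (n + 1)) =>
    if ∀ i ∈ S, s < (i : ℕ) then (w S) ^ 2 else 0)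
    (fun S _ => by split_ifs <;> positivity) (Finset.mem_univ S)
  simpa only [if_pos hS] using this

lemma RAc_smul {s m : ℕ} (A : Matrix (Fin (s + 1)) (Fin m) ℝ)
    (w : Finset (Fin (s + m + 1)) → ℝ) (c : ℝ) (a : Fin (s + 1))
    (J : Finset (Fin (s + m + 1))) :
    RAc A (fun S => c * w S) a J = c * RAc A w a J := by
  unfold RAc
  rw [Finset.mul_sum]
  refine Finset.sum_congr rfl fun i _ => ?_
  unfold cMap
  split_ifs <;> ring

lemma RAcNorm_smul {s m : ℕ} (A : Matrix (Fin (s + 1)) (Fin m) ℝ)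
    (w : Finset (Fin (s + m + 1)) → ℝ) (c : ℝ) :
    RAcNorm A (fun S => c * w S) = |c| * RAcNorm A w := by
  unfold RAcNorm
  simp_rw [RAc_smul, mul_pow, ← Finset.mul_sum]
  rw [Real.sqrt_mul (sq_nonneg _), Real.sqrt_sq_eq_abs]

lemma pibullNorm_smul {s n : ℕ} (w : Finset (Fin (n + 1)) → ℝ) (c : ℝ) :
    pibullNorm s (fun S => c * w S) = |c| * pibullNorm s w := by
  unfold pibullNorm
  simp_rw [mul_pow, ← mul_ite_zero, ← Finset.mul_sum]
  rw [Real.sqrt_mul (sq_nonneg _), Real.sqrt_sq_eq_abs]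

lemma one_le_RAcNorm_of_pibullNorm_eq_zero {s m : ℕ} (A : Matrix (Fin (s + 1)) (Fin m) ℝ)
    (w : Finset (Fin (s + m + 1)) → ℤ) (hw : ∃ S, w S ≠ 0)
    (hp : pibullNorm s (fun S => (w S : ℝ)) = 0) : 1 ≤ RAcNorm A (fun S => (w S : ℝ)) := by
  by_contra! hlt
  have key : ∀ l : ℕ, ∀ S, (S.filter fun i : Fin (s + m + 1) => (i : ℕ) ≤ s).card = l →
      w S = 0 := by
    intro l
    induction l using Nat.strong_induction_on with
    | _ l ih =>
    intro S hS
    by_contra hne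
    have hex : ∃ i ∈ S, (i : ℕ) ≤ s := by
      by_contra! h
      have := abs_le_pibullNorm (s := s) (fun S => (w S : ℝ)) S h
      rw [hp] at this
      exact hne (by exact_mod_cast abs_nonpos_iff.1 this)
    obtain ⟨a, haS, has, ha0⟩ : ∃ a ∈ S, (a : ℕ) ≤ s ∧ (0 : Fin (s + m + 1)) ∉ S.erase a := by
      by_cases h0 : (0 : Fin (s + m + 1)) ∈ S
      · exact ⟨0, h0, by simp, by simp⟩
      · obtain ⟨a, ha, has⟩ := hex
        exact ⟨a, ha, has, fun h => h0 (Finset.mem_of_mem_erase h)⟩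
    have hRA : RAc A (fun S => (w S : ℝ)) ⟨a, by omega⟩ (S.erase a) =
        cMap (fun S => (w S : ℝ)) a (S.erase a) := by
      unfold RAc
      rw [Finset.sum_eq_single a]
      · simp [RA, show (a : ℕ) < s + 1 by omega]
      · intro i _ hia
        by_cases hi : (i : ℕ) < s + 1
        · have : (i : ℕ) ≠ (a : ℕ) := fun h => hia (Fin.ext h)
          simp [RA, hi, this]
        · have : w (insert i (S.erase a)) = 0 := by
            refine ih _ ?_ (insert i (S.erase a)) rfl
            rw [← hS]
            apply Finset.card_lt_card
            rw [Finset.ssubset_iff_of_subset]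
            · refine ⟨a, by simp [haS, has], ?_⟩
              simp [Ne.symm hia]
            · intro x hx
              simp only [Finset.mem_filter, Finset.mem_insert, Finset.mem_erase] at hx ⊢
              obtain ⟨hx1, hx2⟩ := hx
              rcases hx1 with rfl | hx1
              · omega
              · exact ⟨hx1.2, hx2⟩
          simp [cMap, this]
      · simp
    have h1 := (abs_RAc_le_RAcNorm A (fun S => (w S : ℝ)) ⟨a, by omega⟩ (S.erase a)).trans_lt hlt
    rw [hRA] at h1
    unfold cMap at h1
    rw [if_neg (by simpa using ha0), Finset.insert_erase haS, abs_mul, abs_pow, abs_neg, abs_one,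
      one_pow, one_mul] at h1
    have h2 : |w S| < 1 := by
      simp only at h1
      exact_mod_cast h1
    exact hne (Int.abs_lt_one_iff.1 h2)
  obtain ⟨S, hS⟩ := hw
  exact hS (key _ S rfl)

lemma exists_RAcNorm_lower_bound_of_notMem {s m j : ℕ} (A : Matrix (Fin (s + 1)) (Fin m) ℝ)
    {v : ℝ} (hv0 : 0 < v) (hv : v ∉ expSet s m A j) :
    ∃ c > 0, ∀ w : Finset (Fin (s + m + 1)) → ℤ, (∀ S, S.card ≠ j → w S = 0) →
      1 ≤ pibullNorm s (fun S => (w S : ℝ)) →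
      c * pibullNorm s (fun S => (w S : ℝ)) ^ (-(v + 1 - j) / j) ≤
        RAcNorm A (fun S => (w S : ℝ)) := by
  have h1 : ∃ M : ℝ, ∀ w : Finset (Fin (s + m + 1)) → ℤ, (∀ S, S.card ≠ j → w S = 0) →
      M < pibullNorm s (fun S => (w S : ℝ)) →
      pibullNorm s (fun S => (w S : ℝ)) ^ (-(v + 1 - j) / j) ≤
        RAcNorm A (fun S => (w S : ℝ)) := by
    by_contra! h
    exact hv ⟨hv0, h⟩
  obtain ⟨M, hM⟩ := h1
  obtain ⟨k, hk⟩ := exists_nat_gt (max M 1)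
  have hkM : M < k := (le_max_left _ _).trans_lt hk
  have hk1 : (1 : ℝ) < k := (le_max_right _ _).trans_lt hk
  have hk0 : (0 : ℝ) < k := by linarith
  refine ⟨(k : ℝ)⁻¹ * (k : ℝ) ^ (-(v + 1 - j) / j), by positivity, fun w hw hp => ?_⟩
  have h2 := hM (fun S => (k : ℤ) * w S) (fun S hS => by simp [hw S hS])
  push_cast at h2
  rw [pibullNorm_smul, RAcNorm_smul, abs_of_pos hk0] at h2
  have h3 := h2 (by nlinarith)
  rw [Real.mul_rpow hk0.le (by linarith)] at h3
  rw [mul_assoc, inv_mul_le_iff₀ hk0]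
  exact h3

lemma exists_RAcNorm_lower_bound {s m : ℕ} (hs : 1 ≤ s) (A : Matrix (Fin (s + 1)) (Fin m) ℝ)
    (hA : DiophCond s m A) :
    ∃ v : ℝ, (s + m : ℝ) - 1 / 2 ≤ v ∧ v < s + m ∧ ∃ c : ℝ, 0 < c ∧
      ∀ j : ℕ, 1 ≤ j → j ≤ m → ∀ w : Finset (Fin (s + m + 1)) → ℤ,
        (∀ S, S.card ≠ j → w S = 0) → 1 ≤ pibullNorm s (fun S => (w S : ℝ)) →
        c * pibullNorm s (fun S => (w S : ℝ)) ^ (-(v + 1 - j) / j) ≤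
          RAcNorm A (fun S => (w S : ℝ)) := by
  have hv : ∀ᶠ v : ℝ in nhdsWithin ((s : ℝ) + m) (Iio ((s : ℝ) + m)),
      v < s + m ∧ (s + m : ℝ) - 1 / 2 < v ∧ ∀ j ∈ Finset.Icc 1 m, v ∉ expSet s m A j := by
    refine (eventually_mem_nhdsWithin).and (Filter.Eventually.and ?_ ?_)
    · exact eventually_nhdsWithin_of_eventually_nhds (lt_mem_nhds (by linarith))
    · rw [Filter.eventually_all_finset]
      intro j hj
      rw [Finset.mem_Icc] at hj
      obtain ⟨u, hu, hu2⟩ := hA j hj.1 hj.2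
      push_cast at hu
      filter_upwards [eventually_nhdsWithin_of_eventually_nhds (lt_mem_nhds hu)] with v hv hmem
      exact absurd (hu2 v hmem) (not_le.2 hv)
  obtain ⟨v, hvn, hvl, hvj⟩ := hv.exists
  have hs' : (1 : ℝ) ≤ s := by exact_mod_cast hs
  have hv0 : 0 < v := by
    have : (0 : ℝ) ≤ m := by positivity
    linarith
  refine ⟨v, hvl.le, hvn, ?_⟩
  have hc : ∀ᶠ c : ℝ in nhdsWithin (0 : ℝ) (Ioi 0), 0 < c ∧
      ∀ j ∈ Finset.Icc 1 m, ∀ w : Finset (Fin (s + m + 1)) → ℤ,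
        (∀ S, S.card ≠ j → w S = 0) → 1 ≤ pibullNorm s (fun S => (w S : ℝ)) →
        c * pibullNorm s (fun S => (w S : ℝ)) ^ (-(v + 1 - j) / j) ≤
          RAcNorm A (fun S => (w S : ℝ)) := by
    refine (eventually_mem_nhdsWithin).and ?_
    rw [Filter.eventually_all_finset]
    intro j hj
    obtain ⟨c, hc0, hc⟩ := exists_RAcNorm_lower_bound_of_notMem A hv0 (hvj j hj)
    filter_upwards [eventually_nhdsWithin_of_eventually_nhds (gt_mem_nhds hc0)] with c' hc' w hw hp
    refine le_trans ?_ (hc w hw hp)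
    exact mul_le_mul_of_nonneg_right hc'.le (by positivity)
  obtain ⟨c, hc0, hc⟩ := hc.exists
  exact ⟨c, hc0, fun j h1 h2 => hc j (Finset.mem_Icc.2 ⟨h1, h2⟩)⟩

/-- The coordinates of `R_A w` for an integer vector `w`. -/
def RAvec {s m : ℕ} (A : Matrix (Fin (s + 1)) (Fin m) ℝ) (w : Fin (s + m + 1) → ℤ)
    (a : Fin (s + 1)) : ℝ :=
  ∑ i, RA A a i * (w i : ℝ)

/-- The integer vectors in the box where `R_A w` is bounded by `η` and the coordinates other
than the first are bounded by `T`. -/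
def InBox {s m : ℕ} (A : Matrix (Fin (s + 1)) (Fin m) ℝ) (η T : ℝ)
    (w : Fin (s + m + 1) → ℤ) : Prop :=
  (∀ a, |RAvec A w a| ≤ η) ∧ ∀ i, i ≠ 0 → |(w i : ℝ)| ≤ T

lemma abs_det_le_of_inBox {s m : ℕ} (A : Matrix (Fin (s + 1)) (Fin m) ℝ) {η T : ℝ}
    (w : Fin (s + m + 1) → Fin (s + m + 1) → ℤ) (hw : ∀ r, InBox A η T (w r)) :
    |((Matrix.of w).det : ℝ)| ≤ ((s + m + 1).factorial : ℝ) * (η ^ (s + 1) * T ^ m) := by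
  let L : Matrix (Fin (s + m + 1)) (Fin (s + m + 1)) ℝ := Matrix.of fun i k =>
    if h : (i : ℕ) < s + 1 then RA A ⟨i, h⟩ k else if k = i then 1 else 0
  have hL : L.det = 1 := by
    have htri : L.BlockTriangular id := by
      intro i k hki
      have hki' : (k : ℕ) < i := hki
      simp only [L, Matrix.of_apply]
      split_ifs with h h2
      · have h3 : (k : ℕ) < s + 1 := by omega
        have h4 : (k : ℕ) ≠ i := by omega
        simp [RA, h3, h4]
      · subst h2; exact absurd hki' (lt_irrefl _)
      · rfl
    rw [Matrix.det_of_isUpperTriangular htri]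
    refine Finset.prod_eq_one fun i _ => ?_
    simp only [L, Matrix.of_apply]
    split_ifs with h
    · simp [RA, h]
    · rfl
  have h1 : ((Matrix.of w).map (Int.cast : ℤ → ℝ) * L.transpose).det =
      ((Matrix.of w).det : ℝ) := by
    rw [Matrix.det_mul, Matrix.det_transpose, hL, mul_one, Int.cast_det]
  rw [← h1]
  refine (abs_det_le_of_columns _ (fun i => if (i : ℕ) < s + 1 then η else T) ?_).trans ?_
  · intro r i
    rw [Matrix.mul_apply]
    simp only [Matrix.map_apply, Matrix.of_apply, Matrix.transpose_apply, L]
    split_ifs with h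
    · have := (hw r).1 ⟨i, h⟩
      unfold RAvec at this
      simpa only [mul_comm] using this
    · have hi : i ≠ 0 := by
        rintro rfl
        simp at h
      simpa using (hw r).2 i hi
  · have h2 := Fin.prod_univ_eq_prod_range (fun i => if i < s + 1 then η else T) (s + m + 1)
    rw [h2, show s + m + 1 = (s + 1) + m by ring, Finset.prod_range_add]
    simp only [add_lt_iff_neg_left, not_lt_zero, if_false, Finset.prod_const, Finset.card_range]
    rw [Finset.prod_congr rfl (g := fun _ => η) fun x hx => if_pos (Finset.mem_range.1 hx)]
    simp

lemma exists_pibull_coord_ne_zero {s n : ℕ} (w : Finset (Fin (n + 1)) → ℝ)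
    (h : pibullNorm s w ≠ 0) : ∃ S : Finset (Fin (n + 1)), (∀ i ∈ S, s < (i : ℕ)) ∧ w S ≠ 0 := by
  by_contra! h2
  apply h
  unfold pibullNorm
  rw [Real.sqrt_eq_zero', Finset.sum_eq_zero]
  intro S _
  split_ifs with h3
  · simp [h2 S h3]
  · rfl

lemma card_le_of_forall_lt {s m : ℕ} (S : Finset (Fin (s + m + 1)))
    (hS : ∀ i ∈ S, s < (i : ℕ)) : S.card ≤ m := by
  have h : S.card ≤ (Finset.Ico (s + 1) (s + m + 1)).card := by
    refine Finset.card_le_card_of_injOn (fun i => (i : ℕ)) ?_ (Fin.val_injective.injOn)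
    intro i hi
    have := hS i hi
    have := i.2
    simp only [Finset.coe_Ico, Set.mem_Ico]
    omega
  rw [Nat.card_Ico] at h
  omega

lemma le_of_mul_rpow_le {d p F c η T v : ℝ} {j : ℕ} (hj : 1 ≤ j) (hd : 1 ≤ d) (hp : 1 ≤ p)
    (hF : 1 ≤ F) (hc : 0 < c) (hη : 0 ≤ η) (hT : 1 ≤ T) (hv : (j : ℝ) ≤ v + 1)
    (hdp : d * p ≤ F * T ^ j)
    (h : d * (c * p ^ (-(v + 1 - j) / j)) ≤ F * (η * T ^ (j - 1))) :
    d ≤ F ^ (v + 1) / c * (η * T ^ v) := by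
  have hj' : (1 : ℝ) ≤ j := by exact_mod_cast hj
  have hj0 : (0 : ℝ) < j := by linarith
  set e : ℝ := (v + 1 - j) / j with he
  have he0 : 0 ≤ e := div_nonneg (by linarith) hj0.le
  have hneg : -(v + 1 - j) / j = -e := by rw [he]; ring
  have hje : j * e = v + 1 - j := by rw [he]; field_simp
  rw [hneg, Real.rpow_neg (by linarith)] at h
  have hT0 : 0 < T := by linarith
  have hF0 : 0 < F := by linarith
  have hpe : 0 < p ^ e := by positivity
  have hdc : d * c ≤ F * (η * T ^ (j - 1)) * p ^ e := by
    have := mul_le_mul_of_nonneg_right h hpe.le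
    calc d * c = d * (c * (p ^ e)⁻¹) * p ^ e := by field_simp
      _ ≤ _ := this
  have hde : (d * p) ^ e ≤ (F * T ^ j) ^ e :=
    Real.rpow_le_rpow (by positivity) hdp he0
  rw [Real.mul_rpow (by linarith) (by linarith), Real.mul_rpow hF0.le (by positivity)] at hde
  have hd1 : 1 ≤ d ^ e := Real.one_le_rpow hd he0
  have hTj : (T ^ j) ^ e = T ^ (v + 1 - j) := by
    rw [← Real.rpow_natCast, ← Real.rpow_mul hT0.le, hje]
  have hTm : T ^ (j - 1) = T ^ ((j : ℝ) - 1) := by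
    rw [← Real.rpow_natCast, Nat.cast_sub hj]; simp
  have hTT : T ^ (j - 1) * (T ^ j) ^ e = T ^ v := by
    rw [hTj, hTm, ← Real.rpow_add hT0]; congr 1; ring
  have hFF : F * F ^ e ≤ F ^ (v + 1) := by
    calc F * F ^ e = F ^ (1 + e) := by rw [Real.rpow_add hF0, Real.rpow_one]
      _ ≤ _ := by
        apply Real.rpow_le_rpow_of_exponent_le hF
        have : e ≤ j * e := le_mul_of_one_le_left he0 hj'
        linarith
  have h1 : d * c ≤ F ^ (v + 1) * (η * T ^ v) := by
    calc d * c ≤ F * (η * T ^ (j - 1)) * p ^ e := hdc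
      _ ≤ F * (η * T ^ (j - 1)) * (d ^ e * p ^ e) := by
        gcongr
        exact le_mul_of_one_le_left hpe.le hd1
      _ ≤ F * (η * T ^ (j - 1)) * (F ^ e * (T ^ j) ^ e) := by gcongr
      _ = (F * F ^ e) * (η * (T ^ (j - 1) * (T ^ j) ^ e)) := by ring
      _ ≤ F ^ (v + 1) * (η * T ^ v) := by rw [hTT]; gcongr
  rw [div_mul_eq_mul_div, le_div_iff₀ hc]
  exact h1

lemma card_le_of_inBox_small {s m : ℕ} (hs : 1 ≤ s)
    (A : Matrix (Fin (s + 1)) (Fin m) ℝ) {v c : ℝ} (hv : (s + m : ℝ) - 1 / 2 ≤ v) (hc : 0 < c)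
    (hlow : ∀ j : ℕ, 1 ≤ j → j ≤ m → ∀ w : Finset (Fin (s + m + 1)) → ℤ,
        (∀ S, S.card ≠ j → w S = 0) → 1 ≤ pibullNorm s (fun S => (w S : ℝ)) →
        c * pibullNorm s (fun S => (w S : ℝ)) ^ (-(v + 1 - j) / j) ≤
          RAcNorm A (fun S => (w S : ℝ))) :
    ∃ C > (0 : ℝ), ∀ T η : ℝ, 1 ≤ T → 0 < η → η ≤ 1 → ∀ S : Finset (Fin (s + m + 1) → ℤ),
      (∀ w ∈ S, w ≠ 0 ∧ InBox A η T w) → (S.card : ℝ) ≤ C * (η * T ^ v) := by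
  set N := s + m + 1 with hN
  have hs' : (1 : ℝ) ≤ s := by exact_mod_cast hs
  set F : ℝ := (s + 1) * 2 ^ N * (N * N.factorial) with hF
  have hfac1 : (1 : ℝ) ≤ N.factorial := by exact_mod_cast N.factorial_pos
  have hN1 : (1 : ℝ) ≤ N := by exact_mod_cast (by omega : 1 ≤ N)
  have hNN : (1 : ℝ) ≤ N * N.factorial := one_le_mul_of_one_le_of_one_le hN1 hfac1
  have h2N : (1 : ℝ) ≤ 2 ^ N := one_le_pow₀ (by norm_num)
  have hs2 : (1 : ℝ) ≤ (s + 1) * 2 ^ N :=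
    one_le_mul_of_one_le_of_one_le (by linarith) h2N
  have hF1 : 1 ≤ F := one_le_mul_of_one_le_of_one_le hs2 hNN
  have hF0 : 0 < F := by linarith
  refine ⟨3 ^ N * (F + F ^ (v + 1) / c), by positivity, ?_⟩
  intro T η hT hη hη1 S hS
  have hT0 : 0 < T := by linarith
  rcases S.eq_empty_or_nonempty with rfl | ⟨x, hx⟩
  · simp; positivity
  obtain ⟨j, hj1, hjN, w, b, D, hwS, hcard, hwb, J0, hJ0⟩ :=
    exists_wedge_card_le S ⟨x, hx, (hS x hx).1⟩
  have hD1 : 1 ≤ |D| := by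
    refine Int.one_le_abs ?_
    rintro rfl
    have : S.card = 0 := by simpa using hcard
    rw [Finset.card_eq_zero] at this
    simp [this] at hx
  set d : ℝ := |(D : ℝ)| with hd
  have hd1 : 1 ≤ d := by rw [hd]; exact_mod_cast hD1
  have hcard' : (S.card : ℝ) ≤ 3 ^ N * d := by
    have h1 : (S.card : ℝ) ≤ 3 ^ j * d := by
      have : (S.card : ℝ) ≤ ((3 ^ j * D.natAbs : ℕ) : ℝ) := by exact_mod_cast hcard
      simpa [Nat.cast_natAbs] using this
    refine h1.trans ?_
    gcongr
    norm_num
  suffices hmain : d ≤ F * (η * T ^ v) ∨ d ≤ F ^ (v + 1) / c * (η * T ^ v) by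
    refine hcard'.trans ?_
    rw [mul_assoc]
    gcongr
    have h1 : 0 ≤ F * (η * T ^ v) := by positivity
    have h2 : 0 ≤ F ^ (v + 1) / c * (η * T ^ v) := by positivity
    rw [add_mul]
    rcases hmain with h | h <;> linarith
  have hwb' : wedgeOf (fun a i => (w a i : ℝ)) = fun J => (D : ℝ) * (wedgeInt b J : ℝ) := by
    ext J
    rw [← cast_wedgeInt, hwb]
    push_cast
    rfl
  have hbdeg : ∀ J, J.card ≠ j → wedgeInt b J = 0 := fun J hJ => by
    unfold wedgeInt; rw [dif_neg hJ]
  have hfac : (j.factorial : ℝ) ≤ N.factorial := by exact_mod_cast Nat.factorial_le hjN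
  have hpib : d * pibullNorm s (fun J => (wedgeInt b J : ℝ)) ≤ F * T ^ j := by
    have h1 := pibullNorm_wedgeOf_le (s := s) (fun a i => (w a i : ℝ)) hT0.le
      (fun r i hi => (hS _ (hwS r)).2.2 i hi)
    rw [hwb', pibullNorm_smul] at h1
    refine h1.trans ?_
    rw [← mul_assoc, hF]
    gcongr
    · exact le_mul_of_one_le_left (by positivity) (by linarith)
    · exact hfac.trans (le_mul_of_one_le_left (by positivity) hN1)
  have hRA : d * RAcNorm A (fun J => (wedgeInt b J : ℝ)) ≤ F * (η * T ^ (j - 1)) := by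
    obtain ⟨k, rfl⟩ : ∃ k, j = k + 1 := ⟨j - 1, by omega⟩
    have h1 := RAcNorm_le A _ (abs_RAc_wedgeOf_le A (fun a i => (w a i : ℝ)) hη.le hT0.le
      (fun r a => (hS _ (hwS r)).2.1 a) (fun r i hi => (hS _ (hwS r)).2.2 i hi))
    rw [hwb', RAcNorm_smul] at h1
    refine h1.trans ?_
    rw [hF, mul_assoc ((s + 1 : ℝ) * 2 ^ N)]
    have hk : (k.factorial : ℝ) ≤ N.factorial := by
      exact_mod_cast Nat.factorial_le (by omega)
    have hkN : (k : ℝ) + 1 ≤ N := by exact_mod_cast hjN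
    calc _ = (s + 1 : ℝ) * 2 ^ N * (((k : ℝ) + 1) * k.factorial * (η * T ^ k)) := by ring
      _ ≤ _ := by
        rw [Nat.add_sub_cancel]
        gcongr
  by_cases hp : pibullNorm s (fun J => (wedgeInt b J : ℝ)) = 0
  · left
    by_cases hjn : j = N
    · subst hjn
      have hJc : J0.card = N := by
        by_contra h
        exact hJ0 (hbdeg _ h)
      have h1 := abs_det_le_of_inBox A w fun r => (hS _ (hwS r)).2
      have h2 : wedgeInt w J0 = (Matrix.of w).det := by
        unfold wedgeInt
        rw [dif_pos hJc]
        congr 1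
        have hJu : J0 = Finset.univ := by
          rw [← Finset.card_eq_iff_eq_univ, hJc, Fintype.card_fin]
        have h3 : (id : Fin N → Fin N) = J0.orderEmbOfFin hJc :=
          Finset.orderEmbOfFin_unique hJc (fun x => by rw [hJu]; simp) strictMono_id
        ext a c
        simp [← h3]
      have h3 : d ≤ |((Matrix.of w).det : ℝ)| := by
        rw [← h2, hwb, Int.cast_mul, abs_mul]
        refine le_mul_of_one_le_right (abs_nonneg _) ?_
        exact_mod_cast Int.one_le_abs hJ0
      refine (h3.trans h1).trans ?_
      have h4 : η ^ (s + 1) ≤ η := by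
        rw [pow_succ]
        exact mul_le_of_le_one_left hη.le (pow_le_one₀ hη.le hη1)
      have h5 : T ^ m ≤ T ^ v := by
        rw [← Real.rpow_natCast]
        exact Real.rpow_le_rpow_of_exponent_le hT (by linarith)
      have h6 : (N.factorial : ℝ) ≤ F := by
        calc (N.factorial : ℝ) ≤ N * N.factorial := le_mul_of_one_le_left (by positivity) hN1
          _ ≤ F := le_mul_of_one_le_left (by positivity) hs2
      gcongr
    · have h1 := one_le_RAcNorm_of_pibullNorm_eq_zero A (wedgeInt b) ⟨J0, hJ0⟩ hp
      have h2 : d ≤ F * (η * T ^ (j - 1)) :=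
        (le_mul_of_one_le_right (by linarith) h1).trans hRA
      refine h2.trans ?_
      have h5 : T ^ (j - 1) ≤ T ^ v := by
        rw [← Real.rpow_natCast]
        apply Real.rpow_le_rpow_of_exponent_le hT
        have : ((j - 1 : ℕ) : ℝ) + 1 ≤ s + m := by exact_mod_cast (by omega : j - 1 + 1 ≤ s + m)
        linarith
      gcongr
  · right
    obtain ⟨J, hJ, hJ0⟩ := exists_pibull_coord_ne_zero _ hp
    have hJ0' : wedgeInt b J ≠ 0 := by exact_mod_cast hJ0
    have hp1 : 1 ≤ pibullNorm s (fun J => (wedgeInt b J : ℝ)) := by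
      refine le_trans ?_ (abs_le_pibullNorm (fun J => (wedgeInt b J : ℝ)) J hJ)
      exact_mod_cast Int.one_le_abs hJ0'
    have hJc : J.card = j := by
      by_contra h
      exact hJ0' (hbdeg _ h)
    have hjm : j ≤ m := hJc ▸ card_le_of_forall_lt J hJ
    have h1 := hlow j hj1 hjm (wedgeInt b) hbdeg hp1
    have hjm' : (j : ℝ) ≤ m := by exact_mod_cast hjm
    refine le_of_mul_rpow_le hj1 hd1 hp1 hF1 hc hη.le hT (by linarith) hpib ?_
    refine le_trans ?_ hRA
    gcongr

lemma RAvec_eq {s m : ℕ} (A : Matrix (Fin (s + 1)) (Fin m) ℝ) (w : Fin (s + m + 1) → ℤ)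
    (a : Fin (s + 1)) :
    RAvec A w a = (w ⟨a, by omega⟩ : ℝ) + ∑ k : Fin m, A a k * (w ⟨s + 1 + k, by omega⟩ : ℝ) := by
  have h : s + 1 + m = s + m + 1 := by ring
  unfold RAvec
  rw [← (finCongr h).sum_comp, Fin.sum_univ_add]
  congr 1
  · rw [Finset.sum_eq_single a]
    · rw [RA, dif_pos (by simp; omega), if_pos (by simp), one_mul]
      rfl
    · intro b _ hb
      have hb' : (b : ℕ) ≠ a := fun h => hb (Fin.ext h)
      rw [RA, dif_pos (by simp; omega), if_neg (by simpa using hb'), zero_mul]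
    · simp
  · refine Finset.sum_congr rfl fun k _ => ?_
    rw [RA, dif_neg (by simp; omega)]
    congr 2
    ext
    simp

lemma card_le_of_inBox_large {s m : ℕ} (A : Matrix (Fin (s + 1)) (Fin m) ℝ) {η T : ℝ}
    (hη : 1 ≤ η) (hT : 1 ≤ T) (S : Finset (Fin (s + m + 1) → ℤ)) (hS : ∀ w ∈ S, InBox A η T w) :
    (S.card : ℝ) ≤ (5 * η) ^ (s + 1) * (3 * T) ^ m := by
  classical
  let F : (Fin (s + m + 1) → ℤ) → (Fin (s + 1) → ℤ) × (Fin m → ℤ) := fun w =>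
    (fun a => w ⟨a, by omega⟩ + ⌊∑ k : Fin m, A a k * (w ⟨s + 1 + k, by omega⟩ : ℝ)⌋,
      fun k => w ⟨s + 1 + k, by omega⟩)
  have hinj : Function.Injective F := by
    intro w w' h
    obtain ⟨h1, h2⟩ := Prod.ext_iff.1 h
    have h3 : ∀ k : Fin m, w ⟨s + 1 + k, by omega⟩ = w' ⟨s + 1 + k, by omega⟩ :=
      fun k => congrFun h2 k
    ext i
    by_cases hi : (i : ℕ) < s + 1
    · have := congrFun h1 ⟨i, hi⟩
      simpa [F, h3] using this
    · have := h3 ⟨(i : ℕ) - (s + 1), by omega⟩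
      have hi' : s + 1 + ((i : ℕ) - (s + 1)) = i := by omega
      simpa [hi'] using this
  let P : Finset ((Fin (s + 1) → ℤ) × (Fin m → ℤ)) :=
    (Fintype.piFinset fun _ => Finset.Icc (-⌊2 * η⌋) ⌊2 * η⌋) ×ˢ
      (Fintype.piFinset fun _ => Finset.Icc (-⌊T⌋) ⌊T⌋)
  have hmaps : ∀ w ∈ S, F w ∈ P := by
    intro w hw
    obtain ⟨h1, h2⟩ := hS w hw
    simp only [P, F, Finset.mem_product, Fintype.mem_piFinset, Finset.mem_Icc]
    constructor
    · intro a
      have h3 := h1 a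
      rw [RAvec_eq, abs_le] at h3
      have h4 := Int.floor_le (∑ k : Fin m, A a k * (w ⟨s + 1 + k, by omega⟩ : ℝ))
      have h5 := Int.lt_floor_add_one (∑ k : Fin m, A a k * (w ⟨s + 1 + k, by omega⟩ : ℝ))
      constructor
      · rw [neg_le, Int.le_floor]
        push_cast
        linarith
      · rw [Int.le_floor]
        push_cast
        linarith
    · intro k
      have h3 := h2 ⟨s + 1 + k, by omega⟩ (by simp [Fin.ext_iff])
      rw [abs_le] at h3
      constructor
      · rw [neg_le, Int.le_floor]
        push_cast
        linarith
      · rw [Int.le_floor]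
        linarith
  have hcard := Finset.card_le_card_of_injOn F hmaps hinj.injOn
  have hI : ∀ x b : ℝ, 0 ≤ x → 2 * x + 1 ≤ b →
      ((Finset.Icc (-⌊x⌋) ⌊x⌋).card : ℝ) ≤ b := by
    intro x b hx hb
    have h0 : 0 ≤ ⌊x⌋ := Int.floor_nonneg.2 hx
    have h1 : ((Finset.Icc (-⌊x⌋) ⌊x⌋).card : ℤ) = 2 * ⌊x⌋ + 1 := by
      rw [Int.card_Icc, Int.toNat_of_nonneg (by omega)]
      ring
    have h2 : ((Finset.Icc (-⌊x⌋) ⌊x⌋).card : ℝ) = 2 * ⌊x⌋ + 1 := by exact_mod_cast h1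
    have := Int.floor_le x
    linarith
  calc (S.card : ℝ) ≤ P.card := by exact_mod_cast hcard
    _ = ((Finset.Icc (-⌊2 * η⌋) ⌊2 * η⌋).card : ℝ) ^ (s + 1) *
        ((Finset.Icc (-⌊T⌋) ⌊T⌋).card : ℝ) ^ m := by
      simp only [P, Finset.card_product, Fintype.card_piFinset, Finset.prod_const,
        Finset.card_univ, Fintype.card_fin]
      push_cast
      rfl
    _ ≤ _ := by
      gcongr
      · exact hI _ _ (by linarith) (by linarith)
      · exact hI _ _ (by linarith) (by linarith)

lemma card_le_of_inBox {s m : ℕ} (hs : 1 ≤ s)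
    (A : Matrix (Fin (s + 1)) (Fin m) ℝ) {v c H : ℝ} (hv : (s + m : ℝ) - 1 / 2 ≤ v) (hc : 0 < c)
    (hH : 0 < H)
    (hlow : ∀ j : ℕ, 1 ≤ j → j ≤ m → ∀ w : Finset (Fin (s + m + 1)) → ℤ,
        (∀ S, S.card ≠ j → w S = 0) → 1 ≤ pibullNorm s (fun S => (w S : ℝ)) →
        c * pibullNorm s (fun S => (w S : ℝ)) ^ (-(v + 1 - j) / j) ≤
          RAcNorm A (fun S => (w S : ℝ))) :
    ∃ C > (0 : ℝ), ∀ T η : ℝ, 1 ≤ T → 0 < η → η ≤ H * Real.sqrt T →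
      ∀ S : Finset (Fin (s + m + 1) → ℤ),
      (∀ w ∈ S, w ≠ 0 ∧ InBox A η T w) → (S.card : ℝ) ≤ C * T ^ v * η := by
  obtain ⟨C, hC, hsmall⟩ := card_le_of_inBox_small hs A hv hc hlow
  refine ⟨C + 5 ^ (s + 1) * 3 ^ m * H ^ s, by positivity, fun T η hT hη hηH S hS => ?_⟩
  have hT0 : 0 < T := by linarith
  rcases le_total η 1 with h1 | h1
  · have := hsmall T η hT hη h1 S hS
    have h2 : 0 ≤ 5 ^ (s + 1) * 3 ^ m * H ^ s * T ^ v * η := by positivity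
    nlinarith
  · have h2 := card_le_of_inBox_large A h1 hT S fun w hw => (hS w hw).2
    have h3 : η ^ s ≤ H ^ s * Real.sqrt T ^ s := by
      rw [← mul_pow]
      gcongr
    have h4 : Real.sqrt T ^ s * T ^ m ≤ T ^ v := by
      have hs' : (1 : ℝ) ≤ s := by exact_mod_cast hs
      rw [Real.sqrt_eq_rpow, ← Real.rpow_natCast, ← Real.rpow_natCast T m,
        ← Real.rpow_mul hT0.le, ← Real.rpow_add hT0]
      exact Real.rpow_le_rpow_of_exponent_le hT (by linarith)
    calc (S.card : ℝ) ≤ (5 * η) ^ (s + 1) * (3 * T) ^ m := h2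
      _ = 5 ^ (s + 1) * 3 ^ m * η ^ s * T ^ m * η := by ring
      _ ≤ 5 ^ (s + 1) * 3 ^ m * (H ^ s * Real.sqrt T ^ s) * T ^ m * η := by gcongr
      _ = 5 ^ (s + 1) * 3 ^ m * H ^ s * (Real.sqrt T ^ s * T ^ m) * η := by ring
      _ ≤ 5 ^ (s + 1) * 3 ^ m * H ^ s * T ^ v * η := by gcongr
      _ ≤ _ := by
        gcongr
        linarith

lemma sum_inv_le_of_card_le {ι : Type*} (W : Finset ι) (f : ι → ℝ) {N η : ℝ} (k : ℕ)
    (hη : 0 < η)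
    (hN : ∀ y, 0 < y → y ≤ η → ∀ S ⊆ W, (∀ w ∈ S, f w ≤ y) → (S.card : ℝ) ≤ N * y)
    (hf : ∀ w ∈ W, η / 2 ^ k < f w ∧ f w ≤ η) :
    ∑ w ∈ W, (f w)⁻¹ ≤ 2 * N * k := by
  classical
  have h1 : ∀ w ∈ W, (f w)⁻¹ ≤
      ∑ i ∈ Finset.range k, if f w ≤ η / 2 ^ i then 2 ^ (i + 1) / η else 0 := by
    intro w hw
    obtain ⟨hlo, hhi⟩ := hf w hw
    have hex : ∃ i, η / 2 ^ i < f w := ⟨k, hlo⟩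
    have hi := Nat.find_spec hex
    set i := Nat.find hex
    have hik : i ≤ k := Nat.find_min' hex hlo
    have hi0 : i ≠ 0 := by
      intro h0
      rw [h0] at hi
      simp at hi
      linarith
    obtain ⟨l, hl⟩ := Nat.exists_eq_succ_of_ne_zero hi0
    have hl' : f w ≤ η / 2 ^ l := not_lt.1 (Nat.find_min hex (show l < i by omega))
    rw [hl] at hi
    have h2 : (f w)⁻¹ ≤ 2 ^ (l + 1) / η := by
      rw [← inv_div]
      exact inv_anti₀ (by positivity) hi.le
    refine h2.trans ?_
    have h3 := Finset.single_le_sum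
      (f := fun i => if f w ≤ η / 2 ^ i then 2 ^ (i + 1) / η else (0 : ℝ))
      (s := Finset.range k) (fun i _ => by positivity) (Finset.mem_range.2 (show l < k by omega))
    simpa [hl'] using h3
  calc ∑ w ∈ W, (f w)⁻¹
      ≤ ∑ w ∈ W, ∑ i ∈ Finset.range k, if f w ≤ η / 2 ^ i then 2 ^ (i + 1) / η else 0 :=
        Finset.sum_le_sum h1
    _ = ∑ i ∈ Finset.range k, ∑ w ∈ W, if f w ≤ η / 2 ^ i then 2 ^ (i + 1) / η else 0 :=
        Finset.sum_comm
    _ ≤ ∑ i ∈ Finset.range k, 2 * N := by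
        refine Finset.sum_le_sum fun i _ => ?_
        rw [← Finset.sum_filter, Finset.sum_const, nsmul_eq_mul]
        have h3 := hN (η / 2 ^ i) (by positivity)
          (div_le_self hη.le (one_le_pow₀ (by norm_num))) _ (Finset.filter_subset _ W)
          (fun w hw => (Finset.mem_filter.1 hw).2)
        calc _ ≤ N * (η / 2 ^ i) * (2 ^ (i + 1) / η) := by gcongr
          _ = 2 * N := by field_simp; ring
    _ = 2 * N * k := by simp; ring

lemma det_updateRow_one {s : ℕ} (i : Fin s) (g : Fin s → ℝ) :
    (Matrix.updateRow (1 : Matrix (Fin s) (Fin s) ℝ) i g).det = g i := by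
  have h := Matrix.cramer_transpose_apply (1 : Matrix (Fin s) (Fin s) ℝ) g i
  rw [← h]
  simp

lemma volume_slab_le {s : ℕ} (x₀ : EuclideanSpace ℝ (Fin s)) {r : ℝ} (hr : 0 < r) (b : ℝ)
    (g : Fin s → ℝ) (i : Fin s) (hi : g i ≠ 0) {δ : ℝ} (hδ : 0 < δ) :
    volume {x ∈ ball x₀ r | |b + ∑ k, g k * x k| < δ} ≤
      ENNReal.ofReal (2 * δ / |g i| * (2 * r) ^ (s - 1)) := by
  classical
  set M : Matrix (Fin s) (Fin s) ℝ := Matrix.updateRow 1 i g with hM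
  have hdet : M.det = g i := det_updateRow_one i g
  let lo : Fin s → ℝ := Function.update (fun k => x₀ k - r) i (-δ - b)
  let hi' : Fin s → ℝ := Function.update (fun k => x₀ k + r) i (δ - b)
  have hsub : {x ∈ ball x₀ r | |b + ∑ k, g k * x k| < δ} ⊆
      (WithLp.ofLp : EuclideanSpace ℝ (Fin s) → Fin s → ℝ) ⁻¹'
        ((Matrix.toLin' M) ⁻¹' (Set.Icc lo hi')) := by
    rintro x ⟨hx, hxd⟩
    have hk : ∀ k, (Matrix.toLin' M (WithLp.ofLp x)) k =
        if k = i then ∑ l, g l * x l else x k := by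
      intro k
      rw [Matrix.toLin'_apply, Matrix.mulVec, dotProduct]
      split_ifs with h
      · subst h
        simp [hM]
      · simp [hM, Matrix.updateRow_ne h, Matrix.one_apply]
    simp only [Set.mem_preimage, Set.mem_Icc, Pi.le_def, ← forall_and]
    intro k
    rw [hk]
    by_cases h : k = i
    · subst h
      rw [abs_lt] at hxd
      simp only [lo, hi', if_true, Function.update_self]
      constructor <;> linarith [hxd.1, hxd.2]
    · simp only [lo, hi', if_neg h, Function.update_of_ne h]
      have h1 : |x k - x₀ k| ≤ r := by
        have h2 := PiLp.norm_apply_le (x - x₀) k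
        rw [mem_ball_iff_norm] at hx
        rw [Real.norm_eq_abs] at h2
        exact h2.trans hx.le
      rw [abs_le] at h1
      constructor <;> linarith [h1.1, h1.2]
  refine (measure_mono hsub).trans ?_
  have hmeas : MeasurableSet ((Matrix.toLin' M) ⁻¹' (Set.Icc lo hi')) := by
    have hcont : Continuous (Matrix.toLin' M) := LinearMap.continuous_of_finiteDimensional _
    exact hcont.measurable measurableSet_Icc
  rw [(PiLp.volume_preserving_ofLp (Fin s)).measure_preimage hmeas.nullMeasurableSet,
    Measure.addHaar_preimage_linearMap volume (by rw [LinearMap.det_toLin', hdet]; exact hi),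
    LinearMap.det_toLin', hdet, Real.volume_Icc_pi, ← ENNReal.ofReal_prod_of_nonneg,
    ← ENNReal.ofReal_mul (abs_nonneg _)]
  · apply ENNReal.ofReal_le_ofReal
    have : ∏ k, (hi' k - lo k) = 2 * δ * (2 * r) ^ (s - 1) := by
      rw [← Finset.mul_prod_erase Finset.univ _ (Finset.mem_univ i),
        Finset.prod_congr rfl (g := fun _ => 2 * r)]
      · simp [lo, hi', Finset.card_erase_of_mem]
        left; ring
      · intro k hk
        have := Finset.ne_of_mem_erase hk
        simp [lo, hi', this]
        ring
    rw [this, abs_inv]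
    apply le_of_eq
    ring
  · intro k _
    by_cases h : k = i
    · subst h
      simp [lo, hi']
      linarith
    · simp [lo, hi', h]
      linarith

lemma uMat_mulVec_lamVec {s m : ℕ} (A : Matrix (Fin (s + 1)) (Fin m) ℝ) (x : Fin s → ℝ)
    (p : ℤ) (q : Fin (s + m) → ℤ) (i : Fin (1 + s + (s + m))) :
    (uMat A x).mulVec (lamVec s m p q) i = uMat A x i ⟨0, by omega⟩ * p +
      (∑ k : Fin s, uMat A x i (Fin.natAdd (1 + s) (Fin.castAdd m k)) * q (Fin.castAdd m k) +
        ∑ k : Fin m, uMat A x i (Fin.natAdd (1 + s) (Fin.natAdd s k)) * q (Fin.natAdd s k)) := by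
  rw [Matrix.mulVec, dotProduct, Fin.sum_univ_add, Fin.sum_univ_add]
  have h0 : ∀ k : Fin s, lamVec s m p q (Fin.castAdd (s + m) (Fin.natAdd 1 k)) = 0 := by
    intro k
    simp [lamVec]
  have h1 : ∀ k : Fin (s + m), lamVec s m p q (Fin.natAdd (1 + s) k) = q k := by
    intro k
    simp [lamVec]
  have h2 : lamVec s m p q (Fin.castAdd (s + m) (Fin.castAdd s 0)) = p := by
    simp [lamVec]
  simp only [h0, h1, mul_zero, Finset.sum_const_zero, add_zero, Fin.sum_univ_add]
  congr 1
  simp only [Finset.univ_unique, Finset.sum_singleton]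
  congr 1

lemma RAvec_cons {s m : ℕ} (A : Matrix (Fin (s + 1)) (Fin m) ℝ) (p : ℤ)
    (q : Fin (s + m) → ℤ) (a : Fin (s + 1)) :
    RAvec A (Fin.cons p q) a =
      (Fin.cons (p : ℝ) (fun k : Fin s => (q (Fin.castAdd m k) : ℝ)) : Fin (s + 1) → ℝ) a +
        ∑ k : Fin m, A a k * (q (Fin.natAdd s k) : ℝ) := by
  rw [RAvec_eq]
  congr 1
  · refine Fin.cases ?_ (fun i => ?_) a
    · rfl
    · rfl
  · refine Finset.sum_congr rfl fun k _ => ?_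
    have h : (⟨s + 1 + k, by omega⟩ : Fin (s + m + 1)) = Fin.succ (Fin.natAdd s k) := by
      ext
      simp
      omega
    rw [h, Fin.cons_succ]

lemma uMat_mulVec_lamVec_zero {s m : ℕ} (A : Matrix (Fin (s + 1)) (Fin m) ℝ) (x : Fin s → ℝ)
    (p : ℤ) (q : Fin (s + m) → ℤ) :
    (uMat A x).mulVec (lamVec s m p q) ⟨0, by omega⟩ =
      ∑ a, tilde x a * RAvec A (Fin.cons p q) a := by
  rw [uMat_mulVec_lamVec]
  have h1 : ∀ k : Fin s,
      uMat A x ⟨0, by omega⟩ (Fin.natAdd (1 + s) (Fin.castAdd m k)) = x k := by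
    intro k
    simp [uMat]
  have h2 : ∀ k : Fin m, uMat A x ⟨0, by omega⟩ (Fin.natAdd (1 + s) (Fin.natAdd s k)) =
      ∑ a, tilde x a * A a k := by
    intro k
    rw [uMat, if_pos rfl, if_neg (by simp), dif_neg (by simp), dif_neg (by simp)]
    refine Finset.sum_congr rfl fun a _ => ?_
    congr 2
    ext
    simp
    omega
  have h3 : uMat A x ⟨0, by omega⟩ ⟨0, by omega⟩ = 1 := by simp [uMat]
  simp only [h1, h2, h3, RAvec_cons, mul_add, Finset.sum_add_distrib]
  rw [Fin.sum_univ_succ (fun a => tilde x a * (Fin.cons (p : ℝ)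
    (fun k : Fin s => (q (Fin.castAdd m k) : ℝ)) : Fin (s + 1) → ℝ) a)]
  simp only [tilde, Fin.cons_zero, Fin.cons_succ, add_assoc]
  congr 2
  simp only [Finset.sum_mul, Finset.mul_sum]
  rw [Finset.sum_comm]
  simp only [mul_assoc]

lemma uMat_mulVec_lamVec_succ {s m : ℕ} (A : Matrix (Fin (s + 1)) (Fin m) ℝ) (x : Fin s → ℝ)
    (p : ℤ) (q : Fin (s + m) → ℤ) (i : Fin s) :
    (uMat A x).mulVec (lamVec s m p q) ⟨1 + i, by omega⟩ = RAvec A (Fin.cons p q) i.succ := by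
  rw [uMat_mulVec_lamVec, RAvec_cons, Fin.cons_succ]
  have h1 : ∀ k : Fin s, uMat A x ⟨1 + i, by omega⟩ (Fin.natAdd (1 + s) (Fin.castAdd m k)) =
      if k = i then 1 else 0 := by
    intro k
    rw [uMat, if_neg (by simp), dif_pos (by simp), if_neg (by simp), dif_neg (by simp),
      dif_pos (by simp)]
    congr 1
    simp [Fin.ext_iff]
    omega
  have h2 : ∀ k : Fin m, uMat A x ⟨1 + i, by omega⟩ (Fin.natAdd (1 + s) (Fin.natAdd s k)) =
      A i.succ k := by
    intro k
    rw [uMat, if_neg (by simp), dif_pos (by simp), if_neg (by simp), dif_neg (by simp),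
      dif_neg (by simp)]
    congr 1
    · ext
      simp
      omega
    · ext
      simp
      omega
  have h3 : uMat A x ⟨1 + i, by omega⟩ ⟨0, by omega⟩ = 0 := by simp [uMat]
  rw [h3]
  simp [h1, h2]

lemma uMat_mulVec_lamVec_natAdd {s m : ℕ} (A : Matrix (Fin (s + 1)) (Fin m) ℝ) (x : Fin s → ℝ)
    (p : ℤ) (q : Fin (s + m) → ℤ) (i : Fin (s + m)) :
    (uMat A x).mulVec (lamVec s m p q) (Fin.natAdd (1 + s) i) = q i := by
  have h : uMat A x (Fin.natAdd (1 + s) i) = Pi.single (Fin.natAdd (1 + s) i) 1 := by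
    ext j
    rw [uMat, if_neg (by simp), dif_neg (by simp), Pi.single_apply]
  rw [Matrix.mulVec, h, single_one_dotProduct]
  simp [lamVec]

lemma abs_lt_of_abs_div_mul_lt {ε d y : ℝ} (hε : 0 < ε) (hd : 0 < d) (h : |ε / d * y| < ε) :
    |y| < d := by
  rw [abs_mul, abs_of_pos (by positivity), div_mul_eq_mul_div, div_lt_iff₀ hd] at h
  exact lt_of_mul_lt_mul_left h hε.le

lemma bounds_of_norm_lt {s m : ℕ} (A : Matrix (Fin (s + 1)) (Fin m) ℝ) (x : Fin s → ℝ)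
    (p : ℤ) (q : Fin (s + m) → ℤ) {δ K T ε : ℝ} (hδ : 0 < δ) (hK : 0 < K) (hT : 0 < T)
    (hε : 0 < ε) (h : ‖(gMat s m δ K T ε * uMat A x).mulVec (lamVec s m p q)‖ < ε) :
    |∑ a, tilde x a * RAvec A (Fin.cons p q) a| < δ ∧
      (∀ i : Fin s, |RAvec A (Fin.cons p q) i.succ| < K) ∧ ∀ i, |(q i : ℝ)| < T := by
  rw [pi_norm_lt_iff hε] at h
  simp only [gMat, ← Matrix.mulVec_mulVec, Matrix.mulVec_diagonal, Real.norm_eq_abs] at h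
  refine ⟨?_, fun i => ?_, fun i => ?_⟩
  · have h1 := h ⟨0, by omega⟩
    rw [uMat_mulVec_lamVec_zero, if_pos rfl] at h1
    exact abs_lt_of_abs_div_mul_lt hε hδ h1
  · have h1 := h ⟨1 + i, by omega⟩
    rw [uMat_mulVec_lamVec_succ, if_neg (by simp), if_pos (by simp)] at h1
    exact abs_lt_of_abs_div_mul_lt hε hK h1
  · have h1 := h (Fin.natAdd (1 + s) i)
    rw [uMat_mulVec_lamVec_natAdd, if_neg (by simp), if_neg (by simp)] at h1
    exact abs_lt_of_abs_div_mul_lt hε hT h1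

lemma abs_zero_le_of_abs_sum_lt {s : ℕ} (x : Fin s → ℝ) (R : Fin (s + 1) → ℝ) {M G δ : ℝ}
    (hx : ∀ i, |x i| ≤ M) (hG : ∀ i : Fin s, |R i.succ| ≤ G)
    (h : |∑ a, tilde x a * R a| < δ) : |R 0| ≤ δ + s * (M * G) := by
  rw [Fin.sum_univ_succ] at h
  simp only [tilde, Fin.cons_zero, Fin.cons_succ, one_mul] at h
  have h1 : |∑ i : Fin s, x i * R i.succ| ≤ s * (M * G) := by
    refine (Finset.abs_sum_le_sum_abs _ _).trans ?_
    calc ∑ i : Fin s, |x i * R i.succ| ≤ ∑ _i : Fin s, M * G := by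
          refine Finset.sum_le_sum fun i _ => ?_
          rw [abs_mul]
          exact mul_le_mul (hx i) (hG i) (abs_nonneg _) ((abs_nonneg _).trans (hx i))
      _ = _ := by simp
  rw [abs_lt] at h
  rw [abs_le] at h1 ⊢
  constructor <;> linarith [h.1, h.2, h1.1, h1.2]

lemma volume_tilde_slab_le {s : ℕ} (x₀ : EuclideanSpace ℝ (Fin s)) {r : ℝ}
    (hr : 0 < r) {M : ℝ} (hM0 : 0 ≤ M) (hM : ∀ x ∈ ball x₀ r, ∀ i, |x i| ≤ M) {δ : ℝ}
    (hδ : 0 < δ) (R : Fin (s + 1) → ℝ) (hR : 2 * δ ≤ ‖R‖) :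
    volume {x ∈ ball x₀ r | |∑ a, tilde (fun i => x i) a * R a| < δ} ≤
      ENNReal.ofReal (4 * (s * M + 1) * (2 * r) ^ (s - 1) * δ * ‖R‖⁻¹) := by
  rcases Set.eq_empty_or_nonempty
    {x ∈ ball x₀ r | |∑ a, tilde (fun i => x i) a * R a| < δ} with h | ⟨x, hx, hxδ⟩
  · rw [h]
    simp
  have hR0 : 0 < ‖R‖ := by linarith
  have hsM : 0 < (s : ℝ) * M + 1 := by positivity
  obtain ⟨i, hi⟩ : ∃ i : Fin s, ‖R‖ / (2 * (s * M + 1)) ≤ |R i.succ| := by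
    by_contra! hcon
    have h0 := abs_zero_le_of_abs_sum_lt (fun i => x i) R (hM x hx) (fun i => (hcon i).le) hxδ
    have h1 : (s : ℝ) * (M * (‖R‖ / (2 * (s * M + 1)))) < ‖R‖ / 2 := by
      rw [show (s : ℝ) * (M * (‖R‖ / (2 * (s * M + 1)))) = (s * M * ‖R‖) / (2 * (s * M + 1)) by
        ring, div_lt_div_iff₀ (by positivity) (by norm_num)]
      nlinarith
    refine lt_irrefl ‖R‖ ((pi_norm_lt_iff hR0).2 fun a => ?_)
    rw [Real.norm_eq_abs]
    refine Fin.cases (by linarith) (fun i => (hcon i).trans_le ?_) a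
    exact div_le_self hR0.le (by nlinarith [mul_nonneg (Nat.cast_nonneg (α := ℝ) s) hM0])
  have hi0 : 0 < |R i.succ| := lt_of_lt_of_le (by positivity) hi
  have h2 := volume_slab_le x₀ hr (R 0) (fun k => R k.succ) i (abs_pos.1 hi0) hδ
  have hset : {x ∈ ball x₀ r | |∑ a, tilde (fun i => x i) a * R a| < δ} =
      {x ∈ ball x₀ r | |R 0 + ∑ k, R k.succ * x k| < δ} := by
    ext y
    simp only [Fin.sum_univ_succ, tilde, Fin.cons_zero, Fin.cons_succ, one_mul, mul_comm]
  rw [hset]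
  refine h2.trans (ENNReal.ofReal_le_ofReal ?_)
  calc 2 * δ / |R i.succ| * (2 * r) ^ (s - 1)
      ≤ 2 * δ / (‖R‖ / (2 * (s * M + 1))) * (2 * r) ^ (s - 1) := by gcongr
    _ = _ := by field_simp; ring

lemma finite_of_forall_card_le {α : Type*} {W : Set α} (B : ℝ)
    (h : ∀ S : Finset α, (S : Set α) ⊆ W → (S.card : ℝ) ≤ B) : W.Finite := by
  by_contra hinf
  obtain ⟨S, hS, hc⟩ := Set.Infinite.exists_subset_card_eq hinf (⌈B⌉₊ + 1)
  have h1 := h S hS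
  rw [hc] at h1
  push_cast at h1
  linarith [Nat.le_ceil B]

lemma exists_volume_iUnion_le {s m : ℕ} (hs : 1 ≤ s)
    (A : Matrix (Fin (s + 1)) (Fin m) ℝ) {v c H : ℝ} (hv : (s + m : ℝ) - 1 / 2 ≤ v)
    (hvn : v < s + m) (hc : 0 < c) (hH : 0 < H)
    (hlow : ∀ j : ℕ, 1 ≤ j → j ≤ m → ∀ w : Finset (Fin (s + m + 1)) → ℤ,
        (∀ S, S.card ≠ j → w S = 0) → 1 ≤ pibullNorm s (fun S => (w S : ℝ)) →
        c * pibullNorm s (fun S => (w S : ℝ)) ^ (-(v + 1 - j) / j) ≤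
          RAcNorm A (fun S => (w S : ℝ)))
    (x₀ : EuclideanSpace ℝ (Fin s)) {r : ℝ} (hr : 0 < r) {M : ℝ} (hM0 : 0 ≤ M)
    (hM : ∀ x ∈ ball x₀ r, ∀ i, |x i| ≤ M) :
    ∃ C > (0 : ℝ), ∃ c₁ > (0 : ℝ), ∀ (T δ : ℝ) (k : ℕ), 1 ≤ T → 0 < δ → 2 * δ ≤ c₁ * T ^ (-v) →
      H / c₁ * T ^ (s + m + 1) ≤ 2 ^ k →
      volume (⋃ w ∈ {w : Fin (s + m + 1) → ℤ | w ≠ 0 ∧ InBox A (H * Real.sqrt T) T w},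
        {x ∈ ball x₀ r | |∑ a, tilde (fun i => x i) a * RAvec A w a| < δ}) ≤
      ENNReal.ofReal (C * (δ * T ^ v) * k) := by
  obtain ⟨C, hC, hcard⟩ := card_le_of_inBox hs A hv hc hH hlow
  have hs' : (1 : ℝ) ≤ s := by exact_mod_cast hs
  have hm' : (0 : ℝ) ≤ m := Nat.cast_nonneg m
  have hv0 : 0 < v := by linarith
  set c₁ : ℝ := min H (1 / (2 * C)) with hc₁
  have hc₁0 : 0 < c₁ := by positivity
  have hinBox : ∀ {η T : ℝ} {w : Fin (s + m + 1) → ℤ}, 0 ≤ η →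
      (InBox A η T w ↔ ‖RAvec A w‖ ≤ η ∧ ∀ i, i ≠ 0 → |(w i : ℝ)| ≤ T) := by
    intro η T w hη
    rw [InBox, pi_norm_le_iff_of_nonneg hη]
    rfl
  set C₂ : ℝ := 4 * (s * M + 1) * (2 * r) ^ (s - 1) with hC₂
  have hC₂0 : 0 < C₂ := by positivity
  refine ⟨C₂ * (2 * C), by positivity, c₁, hc₁0, fun T δ k hT hδ hδT hk => ?_⟩
  have hT0 : 0 < T := by linarith
  have hsT : 1 ≤ Real.sqrt T := Real.one_le_sqrt.2 hT
  have hη0 : 0 < H * Real.sqrt T := by positivity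
  set W := {w : Fin (s + m + 1) → ℤ | w ≠ 0 ∧ InBox A (H * Real.sqrt T) T w} with hW
  have hfin : W.Finite := finite_of_forall_card_le _ fun S hS => hcard T _ hT hη0 le_rfl S hS
  have hTv1 : T ^ (-v) ≤ 1 := Real.rpow_le_one_of_one_le_of_nonpos hT (by linarith)
  have hlo : ∀ w ∈ W, c₁ * T ^ (-v) < ‖RAvec A w‖ := by
    intro w hw
    by_contra! hcon
    have hη : 0 < c₁ * T ^ (-v) := by positivity
    have h1 : c₁ * T ^ (-v) ≤ H * Real.sqrt T := by
      gcongr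
      · exact min_le_left _ _
      · exact hTv1.trans hsT
    have h2 := hcard T _ hT hη h1 {w} (by
      intro u hu
      rw [Finset.mem_singleton] at hu
      subst hu
      exact ⟨hw.1, (hinBox hη.le).2 ⟨hcon, hw.2.2⟩⟩)
    rw [Finset.card_singleton, Nat.cast_one] at h2
    have h3 : C * T ^ v * (c₁ * T ^ (-v)) = C * c₁ := by
      rw [Real.rpow_neg hT0.le]
      field_simp
    have h4 : C * c₁ ≤ C * (1 / (2 * C)) := by
      gcongr
      exact min_le_right _ _
    have h5 : C * (1 / (2 * C)) = 1 / 2 := by field_simp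
    linarith
  have hkη : H * Real.sqrt T / 2 ^ k ≤ c₁ * T ^ (-v) := by
    rw [div_le_iff₀ (by positivity)]
    have h1 : T ^ v * Real.sqrt T ≤ T ^ (s + m + 1) := by
      rw [Real.sqrt_eq_rpow, ← Real.rpow_add hT0, ← Real.rpow_natCast]
      apply Real.rpow_le_rpow_of_exponent_le hT
      push_cast
      linarith
    calc H * Real.sqrt T = c₁ * T ^ (-v) * (H / c₁ * (T ^ v * Real.sqrt T)) := by
          rw [Real.rpow_neg hT0.le]
          field_simp
      _ ≤ c₁ * T ^ (-v) * (H / c₁ * T ^ (s + m + 1)) := by gcongr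
      _ ≤ c₁ * T ^ (-v) * 2 ^ k := by gcongr
  have hsum := sum_inv_le_of_card_le (N := C * T ^ v) hfin.toFinset (fun w => ‖RAvec A w‖) k hη0
    (fun y hy hyη S hS hSy => hcard T y hT hy hyη S fun w hw => by
      have hwW : w ∈ W := hfin.mem_toFinset.1 (hS hw)
      exact ⟨hwW.1, (hinBox hy.le).2 ⟨hSy w hw, hwW.2.2⟩⟩)
    (fun w hw => by
      have hwW : w ∈ W := hfin.mem_toFinset.1 hw
      exact ⟨hkη.trans_lt (hlo w hwW), ((hinBox hη0.le).1 hwW.2).1⟩)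
  have hunion := measure_biUnion_finset_le (μ := volume) hfin.toFinset
    (fun w => {x ∈ ball x₀ r | |∑ a, tilde (fun i => x i) a * RAvec A w a| < δ})
  simp only [hfin.mem_toFinset] at hunion
  refine hunion.trans ?_
  calc ∑ w ∈ hfin.toFinset,
        volume {x ∈ ball x₀ r | |∑ a, tilde (fun i => x i) a * RAvec A w a| < δ}
      ≤ ∑ w ∈ hfin.toFinset, ENNReal.ofReal (C₂ * δ * ‖RAvec A w‖⁻¹) := by
        refine Finset.sum_le_sum fun w hw => ?_
        have hwW : w ∈ W := hfin.mem_toFinset.1 hw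
        exact volume_tilde_slab_le x₀ hr hM0 hM hδ _ (hδT.trans (hlo w hwW).le)
    _ = ENNReal.ofReal (C₂ * δ * ∑ w ∈ hfin.toFinset, ‖RAvec A w‖⁻¹) := by
        rw [Finset.mul_sum, ENNReal.ofReal_sum_of_nonneg]
        intro w _
        positivity
    _ ≤ _ := by
        apply ENNReal.ofReal_le_ofReal
        calc _ ≤ C₂ * δ * (2 * (C * T ^ v) * k) := by gcongr
          _ = _ := by ring

lemma le_mul_two_rpow {a : ℝ} (ha : 0 < a) (y : ℝ) :
    y ≤ 1 / (a * Real.log 2) * (2 : ℝ) ^ (a * y) := by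
  have hlog : 0 < Real.log 2 := Real.log_pos one_lt_two
  have h1 := Real.add_one_le_exp (Real.log 2 * (a * y))
  rw [Real.rpow_def_of_pos (by norm_num), div_mul_eq_mul_div, le_div_iff₀ (by positivity)]
  linarith

lemma succ_mul_two_rpow_le {a b y : ℝ} (ha : 0 < a) (hba : b ≤ a / 2)
    (hy : 0 ≤ y) :
    (y + 1) * (2 : ℝ) ^ ((y + 1) * -a) ≤ 1 / (a / 2 * Real.log 2) * (2 : ℝ) ^ (-(b * y)) := by
  have hlog : 0 < Real.log 2 := Real.log_pos one_lt_two
  calc (y + 1) * (2 : ℝ) ^ ((y + 1) * -a)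
      ≤ 1 / (a / 2 * Real.log 2) * (2 : ℝ) ^ (a / 2 * (y + 1)) * (2 : ℝ) ^ ((y + 1) * -a) := by
        gcongr
        exact le_mul_two_rpow (half_pos ha) _
    _ = 1 / (a / 2 * Real.log 2) * (2 : ℝ) ^ (-(a / 2 * (y + 1))) := by
        rw [mul_assoc, ← Real.rpow_add (by norm_num)]
        congr 2
        ring
    _ ≤ _ := by
        gcongr
        · norm_num
        · linarith

lemma one_le_rpow_mul {a e B κ y : ℝ} (ha : 0 ≤ a) (he : 0 ≤ e) (hB : 0 ≤ B) (hκ : 0 ≤ κ)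
    (hy : 0 ≤ y) (h : 1 ≤ B * κ * (2 : ℝ) ^ ((y + 1) * -a)) :
    1 ≤ B ^ e * (κ ^ e * (2 : ℝ) ^ (-(a * e / 2 * y))) := by
  have h2 := Real.one_le_rpow h he
  rw [Real.mul_rpow (by positivity) (by positivity), Real.mul_rpow hB hκ,
    ← Real.rpow_mul (by norm_num), mul_assoc] at h2
  refine h2.trans ?_
  gcongr
  · norm_num
  · have := mul_nonneg ha he
    nlinarith [mul_nonneg this hy]

lemma setOf_norm_lt_subset {s m : ℕ} (hs : 1 ≤ s) (hm : 1 ≤ m)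
    (A : Matrix (Fin (s + 1)) (Fin m) ℝ) (x₀ : EuclideanSpace ℝ (Fin s)) {r : ℝ} (hr : 0 < r)
    {M : ℝ} (hM0 : 0 ≤ M) (hM : ∀ x ∈ ball x₀ r, ∀ i, |x i| ≤ M) {κ : ℝ} (hκ : 0 < κ)
    (hκ1 : κ ≤ 1) (β : ℝ) (t : ℕ) :
    {x ∈ ball x₀ r | ∃ (p : ℤ) (q : Fin (s + m) → ℤ), ¬(p = 0 ∧ q = 0) ∧
      ‖(gMat s m (deltaP s m κ t) (KofT s m r t) (TofT t) (epsP s m κ r β t) *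
        uMat A (fun i => x i)).mulVec (lamVec s m p q)‖ < epsP s m κ r β t} ⊆
    ⋃ w ∈ {w : Fin (s + m + 1) → ℤ | w ≠ 0 ∧
        InBox A ((1 + (s * M + 1) * Real.sqrt (((s + m : ℕ) : ℝ) * s / (2 * r ^ 2))) *
          Real.sqrt (TofT t)) (TofT t) w},
      {x ∈ ball x₀ r | |∑ a, tilde (fun i => x i) a * RAvec A w a| < deltaP s m κ t} := by
  rintro x ⟨hx, p, q, hpq, hlt⟩
  have hs' : 0 < (s : ℝ) := by exact_mod_cast hs
  have hT1 : 1 ≤ TofT t := one_le_pow₀ (by norm_num)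
  have hT0 : 0 < TofT t := by linarith
  have hδ : 0 < deltaP s m κ t := by unfold deltaP; positivity
  have hn : 0 < ((s + m : ℕ) : ℝ) := by exact_mod_cast (by omega : 0 < s + m)
  have hK : 0 < KofT s m r t := by unfold KofT; positivity
  have hε : 0 < epsP s m κ r β t := by unfold epsP epsP'; positivity
  obtain ⟨h1, h2, h3⟩ := bounds_of_norm_lt A (fun i => x i) p q hδ hK hT0 hε hlt
  have hδ1 : deltaP s m κ t ≤ 1 := by
    unfold deltaP
    exact div_le_one_of_le₀ (hκ1.trans (one_le_pow₀ (by norm_num))) (by positivity)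
  have hsT : 1 ≤ Real.sqrt (TofT t) := Real.one_le_sqrt.2 hT1
  set κ' := Real.sqrt (((s + m : ℕ) : ℝ) * s / (2 * r ^ 2)) with hκ'
  have hκ0 : 0 ≤ κ' := Real.sqrt_nonneg _
  have hKT : KofT s m r t ≤ κ' * Real.sqrt (TofT t) := by
    unfold KofT TofT
    rw [← hκ', Real.sqrt_eq_rpow, ← Real.rpow_natCast, ← Real.rpow_mul (by norm_num)]
    gcongr
    · norm_num
    · push_cast
      linarith
  have hG : ∀ i : Fin s, |RAvec A (Fin.cons p q) i.succ| ≤ κ' * Real.sqrt (TofT t) :=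
    fun i => (h2 i).le.trans hKT
  have h0 := abs_zero_le_of_abs_sum_lt _ _ (hM x hx) hG h1
  have hκT : 0 ≤ κ' * Real.sqrt (TofT t) := by positivity
  have hsMκ : 0 ≤ s * (M * (κ' * Real.sqrt (TofT t))) := by positivity
  have hbox : InBox A ((1 + (s * M + 1) * κ') * Real.sqrt (TofT t)) (TofT t)
      (Fin.cons p q : Fin (s + m + 1) → ℤ) := by
    constructor
    · refine fun a => Fin.cases ?_ (fun i => ?_) a
      · linarith
      · have := hG i
        linarith
    · intro i hi
      obtain ⟨k, rfl⟩ := Fin.exists_succ_eq.2 hi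
      rw [Fin.cons_succ]
      exact (h3 k).le
  have hne : (Fin.cons p q : Fin (s + m + 1) → ℤ) ≠ 0 := by
    intro h
    refine hpq ⟨by simpa using congrFun h 0, funext fun k => ?_⟩
    simpa using congrFun h k.succ
  exact Set.mem_biUnion (show _ ∈ {w : Fin (s + m + 1) → ℤ | _} from ⟨hne, hbox⟩) ⟨hx, h1⟩

/-- The measure estimate for `Ã_t`: under the diophantine condition there are `β` and an
explicit constant `K₀` with `|Ã_t| ≤ K₀ κ^{1/(s(n+1))} 2^{-((1/(2(n+1))-β)/s)t} |U|`
(here `n = s + m`). -/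
theorem Atilde_measure_bound (s m : ℕ) (hs : 1 ≤ s) (hm : 1 ≤ m)
    (A : Matrix (Fin (s + 1)) (Fin m) ℝ) (hA : DiophCond s m A)
    (x₀ : EuclideanSpace ℝ (Fin s)) (r : ℝ) (hr : 0 < r) :
    ∃ β ∈ Ioo (0 : ℝ) (1 / (2 * ((s + m : ℕ) + 1 : ℝ))), ∃ K0 > (0 : ℝ),
      ∀ κ : ℝ, 0 < κ →
        κ ≤ min 1 (r / ((2 : ℝ) ^ ((s + m : ℝ) - 3 / 2) *
          Real.sqrt (((s + m) * s : ℕ)))) →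
      ∀ t : ℕ,
        volume {x ∈ ball x₀ r | ∃ (p : ℤ) (q : Fin (s + m) → ℤ), ¬(p = 0 ∧ q = 0) ∧
            ‖(gMat s m (deltaP s m κ t) (KofT s m r t) (TofT t) (epsP s m κ r β t) *
                uMat A (fun i => x i)).mulVec (lamVec s m p q)‖ < epsP s m κ r β t} ≤
          ENNReal.ofReal (K0 * κ ^ (1 / ((s : ℝ) * ((s + m : ℕ) + 1 : ℝ))) *
              (2 : ℝ) ^ (-(((1 / (2 * ((s + m : ℕ) + 1 : ℝ)) - β) / s) * t))) *
            volume (ball x₀ r) := by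
  obtain ⟨v, hv, hvn, c, hc, hlow⟩ := exists_RAcNorm_lower_bound hs A hA
  have hs1 : (1 : ℝ) ≤ s := by exact_mod_cast hs
  have hm0 : (0 : ℝ) ≤ m := Nat.cast_nonneg m
  set n : ℝ := ((s + m : ℕ) : ℝ) with hn
  have hn' : n = s + m := by rw [hn]; push_cast; rfl
  have hn1 : 1 ≤ n := by linarith
  set a : ℝ := n - v with ha
  have ha0 : 0 < a := by linarith
  have ha2 : a ≤ 1 / 2 := by linarith
  set e : ℝ := 1 / (s * (n + 1)) with he
  have he0 : 0 < e := by positivity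
  have he1 : e ≤ 1 := by
    rw [he, div_le_one (by positivity)]
    nlinarith
  set M : ℝ := ‖x₀‖ + r with hM
  have hM0 : 0 ≤ M := by positivity
  have hMx : ∀ x ∈ ball x₀ r, ∀ i, |x i| ≤ M := by
    intro x hx i
    have h1 : ‖x i‖ ≤ ‖x‖ := PiLp.norm_apply_le x i
    rw [Real.norm_eq_abs] at h1
    have h2 : ‖x‖ ≤ ‖x₀‖ + ‖x - x₀‖ := norm_le_insert' x x₀
    rw [mem_ball_iff_norm] at hx
    linarith
  set κ' := Real.sqrt (n * s / (2 * r ^ 2)) with hκ'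
  have hκ'0 : 0 ≤ κ' := Real.sqrt_nonneg _
  have hH : 0 < 1 + (s * M + 1) * κ' := by positivity
  obtain ⟨C, hC, c₁, hc₁, hvol⟩ :=
    exists_volume_iUnion_le hs A hv hvn hc hH hlow x₀ hr hM0 hMx
  obtain ⟨k₀, hk₀⟩ := pow_unbounded_of_one_lt ((1 + (s * M + 1) * κ') / c₁) (one_lt_two (α := ℝ))
  set V : ℝ := (volume (ball x₀ r)).toReal with hV
  have hVne : volume (ball x₀ r) ≠ ⊤ := measure_ball_lt_top.ne
  have hV0 : 0 < V := ENNReal.toReal_pos (measure_ball_pos volume x₀ hr).ne' hVne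
  have hVeq : volume (ball x₀ r) = ENNReal.ofReal V := (ENNReal.ofReal_toReal hVne).symm
  set B : ℝ := 2 * 2 ^ (s + m) / c₁ with hB
  have hB0 : 0 < B := by positivity
  set L : ℝ := 1 / (a / 2 * Real.log 2) with hL
  have hlog : 0 < Real.log 2 := Real.log_pos one_lt_two
  have hL0 : 0 < L := by positivity
  set C₁ : ℝ := C * 2 ^ (s + m) * ((k₀ : ℝ) + (n + 1)) * L with hC₁
  have hC₁0 : 0 < C₁ := by positivity
  refine ⟨1 / (2 * (n + 1)) - a / (2 * (n + 1)), ⟨?_, ?_⟩, B ^ e + C₁ / V, by positivity, ?_⟩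
  · rw [← sub_div]
    apply div_pos <;> linarith
  · have : 0 < a / (2 * (n + 1)) := by positivity
    linarith
  intro κ hκ hκle t
  have hκ1 : κ ≤ 1 := hκle.trans (min_le_left _ _)
  have hexp : (1 / (2 * (n + 1)) - (1 / (2 * (n + 1)) - a / (2 * (n + 1)))) / s = a * e / 2 := by
    rw [he]
    field_simp
    ring
  rw [hexp]
  have hT1 : 1 ≤ TofT t := one_le_pow₀ (by norm_num)
  have hT0 : 0 < TofT t := by linarith
  have hT : TofT t = (2 : ℝ) ^ ((t : ℝ) + 1) := by
    unfold TofT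
    rw [← Real.rpow_natCast]
    push_cast
    rfl
  have hδ0 : 0 < deltaP s m κ t := by unfold deltaP; positivity
  have hδ : deltaP s m κ t * TofT t ^ v = κ * 2 ^ (s + m) * TofT t ^ (-a) := by
    have h1 : deltaP s m κ t * TofT t ^ (s + m) = κ * 2 ^ (s + m) := by
      unfold deltaP TofT
      rw [← pow_mul, show (t + 1) * (s + m) = (s + m) * t + (s + m) by ring, pow_add]
      field_simp
    rw [← h1, mul_assoc, ← Real.rpow_natCast (TofT t), ← Real.rpow_add hT0]
    congr 2
    rw [ha, hn]
    ring
  set Q : ℝ := κ ^ e * (2 : ℝ) ^ (-(a * e / 2 * t)) with hQ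
  have hQ0 : 0 < Q := by positivity
  have ht0 : (0 : ℝ) ≤ t := Nat.cast_nonneg t
  rw [mul_assoc]
  by_cases hcase : 2 * deltaP s m κ t ≤ c₁ * TofT t ^ (-v)
  · have hk : (1 + (s * M + 1) * κ') / c₁ * TofT t ^ (s + m + 1) ≤
        2 ^ (k₀ + (t + 1) * (s + m + 1)) := by
      rw [pow_add 2 k₀, pow_mul]
      unfold TofT
      gcongr
    refine ((measure_mono (setOf_norm_lt_subset hs hm A x₀ hr hM0 hMx hκ hκ1 _ t)).trans
      (hvol _ _ _ hT1 hδ0 hcase hk)).trans ?_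
    rw [hVeq, ← ENNReal.ofReal_mul (by positivity)]
    apply ENNReal.ofReal_le_ofReal
    have hkn : ((k₀ + (t + 1) * (s + m + 1) : ℕ) : ℝ) ≤ ((k₀ : ℝ) + (n + 1)) * (t + 1) := by
      push_cast
      rw [hn']
      nlinarith [mul_nonneg (Nat.cast_nonneg (α := ℝ) k₀) ht0]
    have hpoly : ((t : ℝ) + 1) * TofT t ^ (-a) ≤ L * (2 : ℝ) ^ (-(a * e / 2 * t)) := by
      rw [hT, ← Real.rpow_mul (by norm_num)]
      refine succ_mul_two_rpow_le ha0 ?_ ht0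
      linarith [mul_le_of_le_one_right ha0.le he1]
    have hκe : κ ≤ κ ^ e := by
      have := Real.rpow_le_rpow_of_exponent_ge hκ hκ1 he1
      rwa [Real.rpow_one] at this
    calc C * (deltaP s m κ t * TofT t ^ v) * ((k₀ + (t + 1) * (s + m + 1) : ℕ) : ℝ)
        ≤ C * (κ * 2 ^ (s + m) * TofT t ^ (-a)) * (((k₀ : ℝ) + (n + 1)) * (t + 1)) := by
          rw [hδ]
          gcongr
      _ = C * 2 ^ (s + m) * ((k₀ : ℝ) + (n + 1)) * κ * (((t : ℝ) + 1) * TofT t ^ (-a)) := by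
          ring
      _ ≤ C * 2 ^ (s + m) * ((k₀ : ℝ) + (n + 1)) * κ ^ e *
          (L * (2 : ℝ) ^ (-(a * e / 2 * t))) := by gcongr
      _ = C₁ / V * Q * V := by
          rw [hQ, hC₁]
          field_simp
      _ ≤ (B ^ e + C₁ / V) * Q * V := by
          gcongr
          have : 0 ≤ B ^ e := by positivity
          linarith
  · rw [not_le] at hcase
    have hone : 1 ≤ (B ^ e + C₁ / V) * Q := by
      have h1 : 1 ≤ B * κ * TofT t ^ (-a) := by
        have h2 : c₁ ≤ 2 * (deltaP s m κ t * TofT t ^ v) := by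
          rw [Real.rpow_neg hT0.le, ← div_eq_mul_inv, div_lt_iff₀ (by positivity)] at hcase
          linarith
        rw [hδ] at h2
        rw [hB, div_mul_eq_mul_div, div_mul_eq_mul_div, le_div_iff₀ hc₁]
        linarith
      rw [hT, ← Real.rpow_mul (by norm_num)] at h1
      calc (1 : ℝ) ≤ B ^ e * Q := one_le_rpow_mul ha0.le he0.le hB0.le hκ.le ht0 h1
        _ ≤ (B ^ e + C₁ / V) * Q := by
          rw [add_mul]
          exact le_add_of_nonneg_right (by positivity)
    calc _ ≤ volume (ball x₀ r) := measure_mono fun x hx => hx.1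
      _ = 1 * volume (ball x₀ r) := (one_mul _).symm
      _ ≤ _ := by
        gcongr
        rw [← ENNReal.ofReal_one]
        exact ENNReal.ofReal_le_ofReal hone

end
end
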